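/- arXiv:2203.10650 — 2 statements merged into one kernel-verified Lean document; each statement's English description precedes it below -/
import Mathlib

section
/- Given two sequences of non-zero real numbers (λₙ)ₙ≥₁ and (μₙ)ₙ≥₁ satisfying the strict intertwining relations |λ₁| > |μ₁| > |λ₂| > |μ₂| > … > |λₙ| > |μₙ| > … > 0 and with λₙ → 0 (hence μₙ → 0) as n → ∞, there exists a unique self-adjoint compact Hankel operator Γ on ℓ² such that all non-zero eigenvalues of Γ and of ΓS are simple, the set of non-zero eigenvalues of Γ is exactly {λₙ : n ≥ 1}, and the set of non-zero eigenvalues of ΓS is exactly {μₙ : n ≥ 1}. -/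
open Filter Topology ContinuousLinearMap

section Interlacing

open Polynomial Finset

theorem eval_div_prod_sub_eq_sum {ι : Type*} [DecidableEq ι] {s : Finset ι} {v : ι → ℝ}
    (hv : Set.InjOn v s) {P : ℝ[X]} (hP : P.degree < s.card) {x : ℝ} (hx : ∀ i ∈ s, x ≠ v i) :
    P.eval x / ∏ i ∈ s, (x - v i) =
      ∑ i ∈ s, (P.eval (v i) / ∏ j ∈ s.erase i, (v i - v j)) / (x - v i) := by
  have hne : ∏ i ∈ s, (x - v i) ≠ 0 := prod_ne_zero_iff.2 fun i hi => sub_ne_zero.2 (hx i hi)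
  rw [div_eq_iff hne]
  conv_lhs => rw [Lagrange.eq_interpolate hv hP, Lagrange.eval_interpolate_not_at_node _ hx,
    Lagrange.eval_nodal, mul_comm]
  congr 1
  refine sum_congr rfl fun i _ => ?_
  rw [Lagrange.nodalWeight, prod_inv_distrib]
  ring

/-- The weights `q` with `∑ j < N, q j / (a j - x) = 1 - ∏ k < N, (x - b k) / (x - a k)`. -/
noncomputable def cauchyWeight (a b : ℕ → ℝ) (N m : ℕ) : ℝ :=
  (∏ k ∈ range N, (a m - b k)) / ∏ l ∈ (range N).erase m, (a m - a l)

theorem degree_prod_X_sub_C {ι : Type*} (s : Finset ι) (f : ι → ℝ) :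
    (∏ i ∈ s, (X - C (f i)) : ℝ[X]).degree = s.card := by
  simp [degree_prod]

theorem sum_cauchyWeight_div {a b : ℕ → ℝ} (ha : Function.Injective a) (N : ℕ) {x : ℝ}
    (hx : ∀ i, x ≠ a i) :
    ∑ m ∈ range N, cauchyWeight a b N m / (a m - x) =
      1 - ∏ k ∈ range N, ((x - b k) / (x - a k)) := by
  have hne : ∏ i ∈ range N, (x - a i) ≠ 0 :=
    prod_ne_zero_iff.2 fun i _ => sub_ne_zero.2 (hx i)
  set P : ℝ[X] := ∏ i ∈ range N, (X - C (a i)) - ∏ i ∈ range N, (X - C (b i)) with hPdef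
  have hP : P.degree < (range N).card := by
    have h1 := degree_prod_X_sub_C (range N) a
    have h2 := degree_prod_X_sub_C (range N) b
    rw [← h1]
    refine degree_sub_lt_left (h1.trans h2.symm) ?_ ?_
    · exact prod_ne_zero_iff.2 fun i _ => X_sub_C_ne_zero _
    · rw [(monic_prod_X_sub_C a (range N)).leadingCoeff,
        (monic_prod_X_sub_C b (range N)).leadingCoeff]
  have key := eval_div_prod_sub_eq_sum (s := range N) (v := a) ha.injOn hP (x := x)
    fun i _ => hx i
  have hev (y : ℝ) : P.eval y = ∏ i ∈ range N, (y - a i) - ∏ i ∈ range N, (y - b i) := by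
    simp [hPdef, eval_prod]
  rw [hev, sub_div, div_self hne, ← prod_div_distrib] at key
  rw [key]
  refine sum_congr rfl fun m hm => ?_
  rw [hev, prod_eq_zero hm (sub_self _), cauchyWeight, zero_sub, neg_div, neg_div,
    ← div_neg, neg_sub]

/-- Strictly decreasing interlacing positive sequences `a 0 > b 0 > a 1 > b 1 > ⋯ > 0`
tending to zero. -/
structure Interlacing (a b : ℕ → ℝ) : Prop where
  lt_left : ∀ n, b n < a n
  lt_right : ∀ n, a (n + 1) < b n
  pos : ∀ n, 0 < b n
  tendsto : Tendsto a atTop (𝓝 0)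

namespace Interlacing

variable {a b : ℕ → ℝ}

theorem strictAnti (h : Interlacing a b) : StrictAnti a :=
  strictAnti_nat_of_succ_lt fun n => (h.lt_right n).trans (h.lt_left n)

theorem pos_left (h : Interlacing a b) (n : ℕ) : 0 < a n := (h.pos n).trans (h.lt_left n)

theorem lt_of_lt (h : Interlacing a b) {j k : ℕ} (hjk : j < k) : a k < b j :=
  (h.strictAnti.antitone hjk).trans_lt (h.lt_right j)

theorem lt_of_le (h : Interlacing a b) {j k : ℕ} (hjk : j ≤ k) : b k < a j :=
  (h.lt_left k).trans_le (h.strictAnti.antitone hjk)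

theorem ne (h : Interlacing a b) (j k : ℕ) : a j ≠ b k := by
  rcases lt_or_ge k j with hjk | hjk
  · exact (h.lt_of_lt hjk).ne
  · exact (h.lt_of_le hjk).ne'

theorem strictAnti_right (h : Interlacing a b) : StrictAnti b :=
  strictAnti_nat_of_succ_lt fun n => (h.lt_left _).trans (h.lt_right n)

theorem ratio_pos (h : Interlacing a b) {j k : ℕ} (hjk : k ≠ j) :
    0 < (a j - b k) / (a j - a k) := by
  rcases lt_or_gt_of_ne hjk with hl | hl
  · exact div_pos_of_neg_of_neg (sub_neg.2 (h.lt_of_lt hl)) (sub_neg.2 (h.strictAnti hl))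
  · exact div_pos (sub_pos.2 (h.lt_of_le hl.le)) (sub_pos.2 (h.strictAnti hl))

theorem cauchyWeight_pos (h : Interlacing a b) {N m : ℕ} (hm : m < N) :
    0 < cauchyWeight a b N m := by
  rw [cauchyWeight, ← mul_prod_erase _ _ (mem_range.2 hm), mul_div_assoc, ← prod_div_distrib]
  exact mul_pos (sub_pos.2 (h.lt_left m)) (prod_pos fun k hk => h.ratio_pos (ne_of_mem_erase hk))

theorem cauchyWeight_succ (a b : ℕ → ℝ) {N m : ℕ} (hm : m < N) :
    cauchyWeight a b (N + 1) m = cauchyWeight a b N m * ((a m - b N) / (a m - a N)) := by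
  rw [cauchyWeight, cauchyWeight, prod_range_succ, range_add_one,
    erase_insert_of_ne hm.ne', prod_insert (by simp), div_mul_div_comm, mul_comm (a m - a N)]

theorem cauchyWeight_le_succ (h : Interlacing a b) {N m : ℕ} (hm : m < N) :
    cauchyWeight a b N m ≤ cauchyWeight a b (N + 1) m := by
  rw [cauchyWeight_succ a b hm]
  refine le_mul_of_one_le_right (h.cauchyWeight_pos hm).le ?_
  rw [one_le_div (sub_pos.2 (h.strictAnti hm))]
  linarith [h.lt_left N]

theorem sum_cauchyWeight_div_left_le (h : Interlacing a b) (N : ℕ) :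
    ∑ m ∈ range N, cauchyWeight a b N m / a m ≤ 1 := by
  have := sum_cauchyWeight_div (b := b) h.strictAnti.injective N (x := 0)
    fun i => (h.pos_left i).ne
  simp only [sub_zero, zero_sub, neg_div_neg_eq] at this
  rw [this, sub_le_self_iff]
  exact prod_nonneg fun k _ => (div_pos (h.pos k) (h.pos_left k)).le

theorem sum_cauchyWeight_div_sub_eq_one (h : Interlacing a b) {N k : ℕ} (hk : k < N) :
    ∑ m ∈ range N, cauchyWeight a b N m / (a m - b k) = 1 := by
  rw [sum_cauchyWeight_div h.strictAnti.injective N fun i => (h.ne i k).symm,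
    prod_eq_zero (mem_range.2 hk) (by simp), sub_zero]

theorem exists_tendsto_cauchyWeight (h : Interlacing a b) (m : ℕ) :
    ∃ p, Tendsto (fun N => cauchyWeight a b N m) atTop (𝓝 p) ∧
      ∀ N, m < N → cauchyWeight a b N m ≤ p := by
  have hmono : Monotone fun N => cauchyWeight a b (N + (m + 1)) m :=
    monotone_nat_of_le_succ fun N => by
      rw [add_right_comm]
      exact h.cauchyWeight_le_succ (by lia)
  have hbdd : BddAbove (Set.range fun N => cauchyWeight a b (N + (m + 1)) m) := by
    refine ⟨a m, ?_⟩
    rintro _ ⟨N, rfl⟩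
    have h1 := h.sum_cauchyWeight_div_left_le (N + (m + 1))
    have h2 := single_le_sum (f := fun j => cauchyWeight a b (N + (m + 1)) j / a j)
      (fun j hj => (div_pos (h.cauchyWeight_pos (mem_range.1 hj)) (h.pos_left j)).le)
      (mem_range.2 (show m < N + (m + 1) by lia))
    have := h2.trans h1
    rwa [div_le_one (h.pos_left m)] at this
  refine ⟨_, (tendsto_add_atTop_iff_nat (m + 1)).1 (tendsto_atTop_ciSup hmono hbdd), fun N hN => ?_⟩
  obtain ⟨c, rfl⟩ := Nat.exists_eq_add_of_le' (Nat.succ_le_of_lt hN)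
  exact le_ciSup hbdd c

theorem exists_bound_div_sub (h : Interlacing a b) (k : ℕ) :
    ∃ c : ℝ, ∀ j, |1 / (a j - b k)| ≤ c * (1 / a j) := by
  have hlim : Tendsto (fun j => |a j / (a j - b k)|) atTop (𝓝 |0 / (0 - b k)|) :=
    (h.tendsto.div (h.tendsto.sub_const _) (by simpa using (h.pos k).ne')).abs
  obtain ⟨c, hc⟩ := hlim.bddAbove_range
  refine ⟨c, fun j => ?_⟩
  have := hc ⟨j, rfl⟩
  have ha := h.pos_left j
  simp only [abs_div, abs_one, abs_of_pos ha] at this ⊢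
  calc 1 / |a j - b k| = a j / |a j - b k| * (1 / a j) := by field_simp
    _ ≤ _ := by gcongr

theorem exists_weights (h : Interlacing a b) :
    ∃ p : ℕ → ℝ, (∀ j, 0 < p j) ∧ Summable (fun j => p j / a j) ∧ ∑' j, p j / a j ≤ 1 ∧
      ∀ k, HasSum (fun j => p j / (a j - b k)) 1 := by
  choose p hp hle using h.exists_tendsto_cauchyWeight
  have hpos (j) : 0 < p j :=
    (h.cauchyWeight_pos (Nat.lt_succ_self j)).trans_le (hle j _ (Nat.lt_succ_self j))
  have hsum (s : Finset ℕ) : ∑ j ∈ s, p j / a j ≤ 1 := by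
    refine le_of_tendsto (tendsto_finsetSum s fun j _ => (hp j).div_const (a j)) ?_
    filter_upwards [eventually_ge_atTop (s.sup id + 1)] with N hN
    refine le_trans ?_ (h.sum_cauchyWeight_div_left_le N)
    refine sum_le_sum_of_subset_of_nonneg (fun j hj => ?_) fun j hj _ =>
      (div_pos (h.cauchyWeight_pos (mem_range.1 hj)) (h.pos_left j)).le
    have : id j ≤ s.sup id := le_sup hj
    simp only [id] at this
    exact mem_range.2 (by lia)
  have hsummable : Summable fun j => p j / a j :=
    summable_of_sum_le (fun j => (div_pos (hpos j) (h.pos_left j)).le) hsum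
  refine ⟨p, hpos, hsummable, hsummable.tsum_le_of_sum_le hsum, fun k => ?_⟩
  obtain ⟨c, hc⟩ := h.exists_bound_div_sub k
  have hbd (j) : |p j / (a j - b k)| ≤ c * (p j / a j) := by
    have := mul_le_mul_of_nonneg_left (hc j) (hpos j).le
    rw [div_eq_mul_one_div, abs_mul, abs_of_pos (hpos j)]
    exact this.trans_eq (by ring)
  have hs : Summable fun j => p j / (a j - b k) :=
    .of_norm_bounded (hsummable.mul_left c) hbd
  have hlim := tendsto_tsum_of_dominated_convergence (𝓕 := atTop)
    (f := fun N j => if j < N then cauchyWeight a b N j / (a j - b k) else 0)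
    (g := fun j => p j / (a j - b k)) (hsummable.mul_left c)
    (fun j => by
      refine ((hp j).div_const (a j - b k)).congr' ?_
      filter_upwards [eventually_gt_atTop j] with N hN
      rw [if_pos hN])
    (.of_forall fun N j => by
      split_ifs with hj
      · refine le_trans ?_ (hbd j)
        rw [Real.norm_eq_abs, abs_div, abs_div, abs_of_pos (hpos j),
          abs_of_pos (h.cauchyWeight_pos hj)]
        have := hle j N hj
        gcongr
      · simpa using (abs_nonneg _).trans (hbd j))
  have hone : ∑' j, p j / (a j - b k) = 1 := by
    refine tendsto_nhds_unique hlim (tendsto_const_nhds.congr' ?_)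
    filter_upwards [eventually_gt_atTop k] with N hN
    rw [tsum_eq_sum (s := range N) (by simp +contextual), ← h.sum_cauchyWeight_div_sub_eq_one hN]
    exact sum_congr rfl fun j hj => by rw [if_pos (mem_range.1 hj)]
  exact hone ▸ hs.hasSum

theorem hasSum_mul_eval_div_prod {ι : Type*} [DecidableEq ι] {s : Finset ι} {v t : ι → ℝ}
    {a p : ℕ → ℝ} (hv : Set.InjOn v s) {P : ℝ[X]} (hP : P.degree < s.card)
    (hne : ∀ j, ∀ i ∈ s, a j ≠ v i) (hp : ∀ i ∈ s, HasSum (fun j => p j / (a j - v i)) (t i)) :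
    HasSum (fun j => p j * (P.eval (a j) / ∏ i ∈ s, (a j - v i)))
      (∑ i ∈ s, (P.eval (v i) / ∏ j ∈ s.erase i, (v i - v j)) * t i) := by
  have := hasSum_sum fun i hi =>
    (hp i hi).mul_left (P.eval (v i) / ∏ j ∈ s.erase i, (v i - v j))
  refine this.congr_fun fun j => ?_
  rw [eval_div_prod_sub_eq_sum hv hP (hne j), mul_sum]
  exact sum_congr rfl fun i _ => by ring

theorem prod_erase_div_prod_nonpos (h : Interlacing a b) {N m j : ℕ} (hm : m < N) (hj : N ≤ j) :
    (∏ l ∈ (range N).erase m, (a j - a l)) / ∏ k ∈ range N, (a j - b k) ≤ 0 := by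
  rw [← mul_prod_erase _ _ (mem_range.2 hm), mul_comm, ← div_div, ← prod_div_distrib]
  refine div_nonpos_of_nonneg_of_nonpos (prod_nonneg fun k hk => ?_) ?_
  · have hk' : k < N := mem_range.1 (mem_of_mem_erase hk)
    exact div_nonneg_of_nonpos (sub_nonpos.2 (h.strictAnti.antitone (by lia)))
      (sub_nonpos.2 (h.lt_of_lt (by lia)).le)
  · exact sub_nonpos.2 (h.lt_of_lt (by lia)).le

theorem cauchyWeight_le (h : Interlacing a b) {p : ℕ → ℝ} (hp : ∀ j, 0 ≤ p j)
    (hsum : ∀ k, HasSum (fun j => p j / (a j - b k)) 1) {N m : ℕ} (hm : m < N) :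
    cauchyWeight a b N m ≤ p m := by
  set P : ℝ[X] := ∏ l ∈ (range N).erase m, (X - C (a l)) with hPdef
  have hcard : ((range N).erase m).card = N - 1 := by
    rw [card_erase_of_mem (mem_range.2 hm), card_range]
  have hdeg : P.degree = ((N - 1 : ℕ) : WithBot ℕ) := by
    rw [hPdef, degree_prod_X_sub_C, hcard]
  have hlt : P.degree < (range N).card := by
    rw [hdeg, card_range]
    exact_mod_cast (by lia : N - 1 < N)
  have hev (y : ℝ) : P.eval y = ∏ l ∈ (range N).erase m, (y - a l) := by
    simp [hPdef, eval_prod]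
  have hb : Set.InjOn b (range N) := h.strictAnti_right.injective.injOn
  have key := hasSum_mul_eval_div_prod hb hlt (fun j i _ => h.ne j i) (fun k _ => hsum k)
  have hone : P.coeff ((range N).card - 1) = 1 := by
    have : P.Monic := monic_prod_X_sub_C _ _
    rw [card_range, ← natDegree_eq_of_degree_eq_some hdeg]
    exact this
  simp only [mul_one] at key
  rw [← Lagrange.coeff_eq_sum hb hlt, hone] at key
  have hle : 1 ≤ p m * (P.eval (a m) / ∏ i ∈ range N, (a m - b i)) := by
    refine hasSum_le (fun j => ?_) key (hasSum_ite_eq m _)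
    split_ifs with hj
    · rw [hj]
    · refine mul_nonpos_of_nonneg_of_nonpos (hp j) ?_
      rw [hev]
      rcases lt_or_ge j N with hjN | hjN
      · rw [prod_eq_zero (mem_erase.2 ⟨hj, mem_range.2 hjN⟩) (sub_self _), zero_div]
      · exact h.prod_erase_div_prod_nonpos hm hjN
  have hq : P.eval (a m) / ∏ i ∈ range N, (a m - b i) = (cauchyWeight a b N m)⁻¹ := by
    rw [hev, cauchyWeight, inv_div]
  rw [hq, ← div_eq_mul_inv, one_le_div (h.cauchyWeight_pos hm)] at hle
  exact hle

theorem le_cauchyWeight_mul (h : Interlacing a b) {p : ℕ → ℝ} (hp : ∀ j, 0 ≤ p j)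
    (hs : Summable fun j => p j / a j) (hs1 : ∑' j, p j / a j ≤ 1)
    (hsum : ∀ k, HasSum (fun j => p j / (a j - b k)) 1) {N m : ℕ} (hm : m < N) :
    p m ≤ cauchyWeight a b N m * (a m / (a m - a N)) := by
  set v : ℕ → ℝ := fun k => if k < N then b k else 0 with hvdef
  set t : ℕ → ℝ := fun k => if k < N then 1 else ∑' j, p j / a j with htdef
  set P : ℝ[X] := (∏ l ∈ (range N).erase m, (X - C (a l))) * (X - C (a N)) with hPdef
  have hvN (k) (hk : k ∈ range N) : v k = b k := if_pos (mem_range.1 hk)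
  have hv0 : v N = 0 := if_neg (lt_irrefl N)
  have hmonic : P.Monic := (monic_prod_X_sub_C _ _).mul (monic_X_sub_C _)
  have hdeg : P.degree = (N : WithBot ℕ) := by
    rw [hPdef, degree_mul, degree_prod_X_sub_C, degree_X_sub_C, card_erase_of_mem (mem_range.2 hm),
      card_range]
    exact_mod_cast (by lia : N - 1 + 1 = N)
  have hlt : P.degree < (range (N + 1)).card := by
    rw [hdeg, card_range]
    exact_mod_cast Nat.lt_succ_self N
  have hev (y : ℝ) : P.eval y = (∏ l ∈ (range N).erase m, (y - a l)) * (y - a N) := by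
    simp [hPdef, eval_prod]
  have hv : Set.InjOn v (range (N + 1)) := by
    intro i hi j hj hij
    have hi' : i < N + 1 := mem_range.1 hi
    have hj' : j < N + 1 := mem_range.1 hj
    simp only [hvdef] at hij
    have hbi := h.pos i
    have hbj := h.pos j
    split_ifs at hij with h1 h2 h2
    · exact h.strictAnti_right.injective hij
    · exact absurd hij hbi.ne'
    · exact absurd hij hbj.ne
    · lia
  have hne (j) : ∀ i ∈ range (N + 1), a j ≠ v i := fun i _ => by
    simp only [hvdef]
    split_ifs
    · exact h.ne j i
    · exact (h.pos_left j).ne'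
  have key := hasSum_mul_eval_div_prod hv hlt hne (p := p) (t := t) fun i _ => by
    simp only [hvdef, htdef]
    split_ifs
    · exact hsum i
    · simpa using hs.hasSum
  have hone : ∑ i ∈ range (N + 1), P.eval (v i) / ∏ j ∈ (range (N + 1)).erase i, (v i - v j) =
      1 := by
    rw [← Lagrange.coeff_eq_sum hv hlt, card_range, Nat.add_sub_cancel,
      ← natDegree_eq_of_degree_eq_some hdeg]
    exact hmonic
  have hr0 : 0 ≤ P.eval (v N) / ∏ j ∈ (range (N + 1)).erase N, (v N - v j) := by
    have herase : (range (N + 1)).erase N = range N := by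
      rw [range_add_one, erase_insert (by simp)]
    have hprod : ∏ k ∈ range N, (0 - v k) = ∏ k ∈ range N, (0 - b k) :=
      prod_congr rfl fun k hk => by rw [hvN k hk]
    rw [herase, hv0, hev, hprod, ← mul_prod_erase _ _ (mem_range.2 hm), mul_comm,
      mul_div_mul_comm, ← prod_div_distrib]
    refine mul_nonneg ?_ (prod_nonneg fun k _ => ?_)
    · simpa using (div_pos (h.pos_left N) (h.pos m)).le
    · simpa using (div_pos (h.pos_left k) (h.pos k)).le
  have hle1 : ∑ i ∈ range (N + 1),
      (P.eval (v i) / ∏ j ∈ (range (N + 1)).erase i, (v i - v j)) * t i ≤ 1 := by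
    rw [sum_range_succ] at hone ⊢
    have htN : t N = ∑' j, p j / a j := if_neg (lt_irrefl N)
    rw [sum_congr rfl fun i hi => by rw [show t i = 1 from if_pos (mem_range.1 hi), mul_one], htN]
    nlinarith [mul_le_mul_of_nonneg_left hs1 hr0]
  have hden (j) : ∏ i ∈ range (N + 1), (a j - v i) = (∏ i ∈ range N, (a j - b i)) * a j := by
    rw [prod_range_succ, hv0, sub_zero, prod_congr rfl fun k hk => by rw [hvN k hk]]
  replace key := key.congr_fun (g := fun j => p j * ((∏ l ∈ (range N).erase m, (a j - a l)) /
      (∏ i ∈ range N, (a j - b i)) * ((a j - a N) / a j))) fun j => by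
    rw [hden, hev, mul_div_mul_comm]
  have hle := hasSum_le (f := fun j => if j = m then
      p m * ((∏ l ∈ (range N).erase m, (a m - a l)) / (∏ i ∈ range N, (a m - b i)) *
        ((a m - a N) / a m)) else 0) (fun j => ?_) (hasSum_ite_eq m _) key
  · have hle' := hle.trans hle1
    have hq : (∏ l ∈ (range N).erase m, (a m - a l)) / (∏ i ∈ range N, (a m - b i)) =
        (cauchyWeight a b N m)⁻¹ := by rw [cauchyWeight, inv_div]
    have hw := h.cauchyWeight_pos hm
    have ham := h.pos_left m
    have hd : 0 < a m - a N := sub_pos.2 (h.strictAnti hm)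
    rw [hq] at hle'
    calc p m = p m * ((cauchyWeight a b N m)⁻¹ * ((a m - a N) / a m)) *
          (cauchyWeight a b N m * (a m / (a m - a N))) := by field_simp
      _ ≤ 1 * (cauchyWeight a b N m * (a m / (a m - a N))) := by gcongr
      _ = _ := one_mul _
  · split_ifs with hj
    · rw [hj]
    · refine mul_nonneg (hp j) ?_
      rcases lt_or_ge j N with hjN | hjN
      · rw [prod_eq_zero (mem_erase.2 ⟨hj, mem_range.2 hjN⟩) (sub_self _), zero_div, zero_mul]
      · refine mul_nonneg_of_nonpos_of_nonpos (h.prod_erase_div_prod_nonpos hm hjN) ?_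
        exact div_nonpos_of_nonpos_of_nonneg (sub_nonpos.2 (h.strictAnti.antitone hjN))
          (h.pos_left j).le

theorem weights_le (h : Interlacing a b) {p p' : ℕ → ℝ} (hp : ∀ j, 0 ≤ p j)
    (hs : Summable fun j => p j / a j) (hs1 : ∑' j, p j / a j ≤ 1)
    (hsum : ∀ k, HasSum (fun j => p j / (a j - b k)) 1) (hp' : ∀ j, 0 ≤ p' j)
    (hsum' : ∀ k, HasSum (fun j => p' j / (a j - b k)) 1) (m : ℕ) : p m ≤ p' m := by
  have ham := h.pos_left m
  have hlim : Tendsto (fun N => p' m * (a m / (a m - a N))) atTop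
      (𝓝 (p' m * (a m / (a m - 0)))) :=
    (tendsto_const_nhds.div (tendsto_const_nhds.sub h.tendsto) (by simpa using ham.ne')).const_mul _
  rw [sub_zero, div_self ham.ne', mul_one] at hlim
  refine ge_of_tendsto hlim ?_
  filter_upwards [eventually_gt_atTop m] with N hN
  have hd : 0 < a m - a N := sub_pos.2 (h.strictAnti hN)
  refine (h.le_cauchyWeight_mul hp hs hs1 hsum hN).trans ?_
  have := h.cauchyWeight_le hp' hsum' hN
  gcongr

theorem exists_eq_right (h : Interlacing a b) {p : ℕ → ℝ} (hp : ∀ j, 0 < p j)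
    (hs : Summable fun j => p j / a j) (hs1 : ∑' j, p j / a j ≤ 1)
    (hsum : ∀ k, HasSum (fun j => p j / (a j - b k)) 1) {z : ℝ} (hz : z ≠ 0) (hza : ∀ j, a j ≠ z)
    (hpz : HasSum (fun j => p j / (a j - z)) 1) : ∃ k, z = b k := by
  rcases lt_or_gt_of_ne hz with hneg | hpos
  · refine absurd (hasSum_lt (i := 0) (fun j => ?_) ?_ hpz hs.hasSum) (not_lt.2 hs1)
    · have := h.pos_left j
      have := hp j
      gcongr
      linarith
    · have := h.pos_left 0
      have := hp 0
      gcongr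
      linarith
  · have hex : ∃ n, a n < z := (h.tendsto.eventually (gt_mem_nhds hpos)).exists
    classical
    obtain ⟨n, hn, hmin⟩ : ∃ n, a n < z ∧ ∀ m < n, z < a m :=
      ⟨Nat.find hex, Nat.find_spec hex, fun m hm =>
        lt_of_le_of_ne (not_lt.1 (Nat.find_min hex hm)) (hza m).symm⟩
    rcases n with _ | k
    · have : (1 : ℝ) ≤ 0 := hasSum_le (fun j => by
        refine div_nonpos_of_nonneg_of_nonpos (hp j).le (sub_nonpos.2 ?_)
        exact (h.strictAnti.antitone (zero_le)).trans hn.le) hpz hasSum_zero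
      linarith
    · refine ⟨k, ?_⟩
      have hdiff := (hpz.sub (hsum k)).congr_fun (g := fun j =>
        (z - b k) * (p j / ((a j - z) * (a j - b k)))) fun j => by
          have h1 := sub_ne_zero.2 (hza j)
          have h2 := sub_ne_zero.2 (h.ne j k)
          field_simp
          ring
      have hterm (j) : 0 < p j / ((a j - z) * (a j - b k)) := by
        refine div_pos (hp j) ?_
        rcases lt_or_ge k j with hj | hj
        · exact mul_pos_of_neg_of_neg
            (sub_neg.2 ((h.strictAnti.antitone (Nat.succ_le_of_lt hj)).trans_lt hn))
            (sub_neg.2 (h.lt_of_lt hj))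
        · exact mul_pos (sub_pos.2 (hmin j (by lia))) (sub_pos.2 (h.lt_of_le hj))
      rw [sub_self] at hdiff
      by_contra hne
      have hdiff' := hdiff.mul_left (z - b k)⁻¹
      simp only [inv_mul_cancel_left₀ (sub_ne_zero.2 hne), mul_zero] at hdiff'
      exact (hasSum_lt (i := 0) (fun j => (hterm j).le) (hterm 0) hasSum_zero hdiff').ne rfl

end Interlacing
end Interlacing

section Operators

open Module.End InnerProductSpace

variable {E : Type*} [NormedAddCommGroup E] [InnerProductSpace ℂ E]

theorem eq_zero_of_inner_hilbertBasis {ι : Type*} (e : HilbertBasis ι ℂ E) {x : E}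
    (hx : ∀ i, inner ℂ (e i) x = 0) : x = 0 := by
  have := e.hasSum_repr x
  simp only [e.repr_apply_apply, hx, zero_smul] at this
  exact this.unique hasSum_zero

theorem ext_inner_hilbertBasis {ι : Type*} (e : HilbertBasis ι ℂ E) {x y : E}
    (h : ∀ i, inner ℂ (e i) x = inner ℂ (e i) y) : x = y := by
  rw [← sub_eq_zero]
  exact eq_zero_of_inner_hilbertBasis e fun i => by rw [inner_sub_right, h, sub_self]

theorem isCompactOperator_rankOne (x y : E) : IsCompactOperator (rankOne ℂ x y) := by
  rw [rankOne_def']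
  exact (isCompactOperator_of_locallyCompactSpace_dom (innerSL ℂ y)).clm_comp (toSpanSingleton ℂ x)

theorem exists_norm_smul_eq_one {x : E} (hx : x ≠ 0) (v : E) :
    ∃ t : ℂ, ‖t • x‖ = 1 ∧ ∃ r : ℝ, 0 ≤ r ∧ inner ℂ (t • x) v = r := by
  have hx' : ‖x‖ ≠ 0 := norm_ne_zero_iff.2 hx
  rcases eq_or_ne (inner ℂ x v) 0 with h | h
  · refine ⟨(‖x‖ : ℂ)⁻¹, ?_, 0, le_rfl, ?_⟩
    · simp [norm_smul, hx']
    · simp [h]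
  · have h' : ‖inner ℂ x v‖ ≠ 0 := norm_ne_zero_iff.2 h
    refine ⟨(inner ℂ x v) / ((‖inner ℂ x v‖ : ℂ) * ‖x‖), ?_, ‖inner ℂ x v‖ / ‖x‖,
      by positivity, ?_⟩
    · rw [norm_smul, norm_div, norm_mul]
      simp only [Complex.norm_real, norm_norm]
      field_simp
    · have hc : (‖x‖ : ℂ) ≠ 0 := by exact_mod_cast hx'
      have hc' : (‖inner ℂ x v‖ : ℂ) ≠ 0 := by exact_mod_cast h'
      rw [inner_smul_left, map_div₀, map_mul, Complex.conj_ofReal, Complex.conj_ofReal,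
        div_mul_eq_mul_div, Complex.conj_mul']
      push_cast
      field_simp

variable [CompleteSpace E]

theorem IsSelfAdjoint.inner_apply_comm {C : E →L[ℂ] E} (hC : IsSelfAdjoint C) (x y : E) :
    inner ℂ (C x) y = inner ℂ x (C y) :=
  ContinuousLinearMap.isSelfAdjoint_iff_isSymmetric.1 hC x y

theorem ContinuousLinearMap.ext_of_eqOn_of_orthogonal {ι : Type*} {F : Type*}
    [NormedAddCommGroup F] [NormedSpace ℂ F] {C C' : E →L[ℂ] F} (f : ι → E)
    (h : ∀ i, C (f i) = C' (f i))
    (h' : ∀ x, (∀ i, inner ℂ (f i) x = 0) → C x = C' x) : C = C' := by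
  set K : Submodule ℂ E := (Submodule.span ℂ (Set.range f)).topologicalClosure with hK
  have : CompleteSpace K := (Submodule.isClosed_topologicalClosure _).completeSpace_coe
  have hle : K ≤ (C - C').ker := by
    refine Submodule.topologicalClosure_minimal _ (Submodule.span_le.2 ?_) (C - C').isClosed_ker
    rintro _ ⟨i, rfl⟩
    simp [h]
  have hle' : Kᗮ ≤ (C - C').ker := by
    intro x hx
    have : C x = C' x := h' x fun i =>
      hx (f i) (Submodule.le_topologicalClosure _ (Submodule.subset_span ⟨i, rfl⟩))
    simp [this]
  have htop : (C - C').ker = ⊤ := top_le_iff.1 (K.sup_orthogonal_of_hasOrthogonalProjection ▸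
    sup_le hle hle')
  ext x
  have : x ∈ (C - C').ker := htop ▸ Submodule.mem_top
  simpa [sub_eq_zero] using this

theorem IsCompactOperator.apply_eq_zero_of_orthogonal {C : E →L[ℂ] E} (hcomp : IsCompactOperator C)
    (hsa : IsSelfAdjoint C) {x : E}
    (hx : ∀ z : ℂ, z ≠ 0 → ∀ v, C v = z • v → inner ℂ v x = 0) : C x = 0 := by
  have hsymm : C.IsSymmetric := ContinuousLinearMap.isSelfAdjoint_iff_isSymmetric.1 hsa
  have hbot := ContinuousLinearMap.orthogonalComplement_iSup_eigenspaces_eq_bot hcomp hsymm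
  rw [← Submodule.mem_bot ℂ, ← hbot, ← Submodule.iInf_orthogonal, Submodule.mem_iInf]
  intro z v hv
  have hCv : C v = z • v := mem_eigenspace_iff.1 hv
  rw [← hsa.inner_apply_comm, hCv, inner_smul_left]
  rcases eq_or_ne z 0 with rfl | hz
  · simp
  · rw [hx z hz v hCv, mul_zero]

theorem isSelfAdjoint_rankOne_self (x : E) : IsSelfAdjoint (rankOne ℂ x x) := by
  rw [ContinuousLinearMap.isSelfAdjoint_iff', adjoint_rankOne]

theorem summable_smul_rankOne {g : ℕ → E} (hg : Orthonormal ℂ g) {c : ℕ → ℝ}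
    (hc : Tendsto c atTop (𝓝 0)) :
    Summable fun j => (c j : ℂ) • rankOne ℂ (g j) (g j) := by
  set R : ℕ → E →L[ℂ] E := fun j => (c j : ℂ) • rankOne ℂ (g j) (g j) with hR
  rw [summable_iff_vanishing_norm]
  intro ε hε
  obtain ⟨N, hN⟩ := (Metric.tendsto_atTop.1 hc) (ε / 2) (by positivity)
  refine ⟨Finset.range N, fun t ht => ?_⟩
  refine (ContinuousLinearMap.opNorm_le_bound _ (half_pos hε).le fun x => ?_).trans_lt
    (half_lt_self hε)
  have happ : (∑ i ∈ t, R i) x = ∑ i ∈ t, ((c i : ℂ) * inner ℂ (g i) x) • g i := by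
    simp [hR, mul_smul]
  have hsq : ‖(∑ i ∈ t, R i) x‖ ^ 2 = ∑ i ∈ t, ‖(c i : ℂ) * inner ℂ (g i) x‖ ^ 2 := by
    have h1 := hg.inner_sum (fun i => (c i : ℂ) * inner ℂ (g i) x)
      (fun i => (c i : ℂ) * inner ℂ (g i) x) t
    simp only [Complex.conj_mul'] at h1
    rw [happ]
    apply Complex.ofReal_injective
    push_cast
    rw [← h1, inner_self_eq_norm_sq_to_K]
    rfl
  refine abs_le_of_sq_le_sq' ?_ (by positivity) |>.2
  calc ‖(∑ i ∈ t, R i) x‖ ^ 2 = ∑ i ∈ t, ‖(c i : ℂ) * inner ℂ (g i) x‖ ^ 2 := hsq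
    _ ≤ ∑ i ∈ t, (ε / 2) ^ 2 * ‖inner ℂ (g i) x‖ ^ 2 := by
      refine Finset.sum_le_sum fun i hi => ?_
      have hi' : N ≤ i := by
        have := Finset.disjoint_left.1 ht hi
        simpa using this
      have := hN i hi'
      rw [Real.dist_eq, sub_zero] at this
      rw [norm_mul, mul_pow, Complex.norm_real, Real.norm_eq_abs]
      gcongr
    _ = (ε / 2) ^ 2 * ∑ i ∈ t, ‖inner ℂ (g i) x‖ ^ 2 := by rw [Finset.mul_sum]
    _ ≤ (ε / 2) ^ 2 * ‖x‖ ^ 2 := by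
      gcongr
      exact hg.sum_inner_products_le x
    _ = (ε / 2 * ‖x‖) ^ 2 := by ring

theorem isSelfAdjoint_smul_rankOne (c : ℝ) (x : E) :
    IsSelfAdjoint ((c : ℂ) • rankOne ℂ x x) :=
  IsSelfAdjoint.smul (Complex.conj_ofReal c) (isSelfAdjoint_rankOne_self x)

theorem isSelfAdjoint_of_hasSum {R : ℕ → E →L[ℂ] E} {C : E →L[ℂ] E} (h : HasSum R C)
    (hR : ∀ j, IsSelfAdjoint (R j)) : IsSelfAdjoint C := by
  have h2 := h.star
  simp only [fun j => (hR j).star_eq] at h2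
  exact h2.unique h

theorem isCompactOperator_of_hasSum {R : ℕ → E →L[ℂ] E} {C : E →L[ℂ] E} (h : HasSum R C)
    (hR : ∀ j, IsCompactOperator (R j)) : IsCompactOperator C :=
  isCompactOperator_of_tendsto h (.of_forall fun _ =>
    (compactOperator (RingHom.id ℂ) E E).sum_mem fun j _ => hR j)

theorem exists_diagonal_operator {g : ℕ → E} (hg : Orthonormal ℂ g) {c : ℕ → ℝ}
    (hc : Tendsto c atTop (𝓝 0)) :
    ∃ C : E →L[ℂ] E, IsSelfAdjoint C ∧ IsCompactOperator C ∧ (∀ j, C (g j) = (c j : ℂ) • g j) ∧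
      ∀ x, (∀ j, inner ℂ (g j) x = 0) → C x = 0 := by
  obtain ⟨C, hC⟩ := summable_smul_rankOne hg hc
  have happ (x : E) : HasSum (fun j => ((c j : ℂ) * inner ℂ (g j) x) • g j) (C x) := by
    have := (ContinuousLinearMap.apply ℂ E x).hasSum hC
    simpa [mul_smul] using this
  refine ⟨C, isSelfAdjoint_of_hasSum hC fun j => isSelfAdjoint_smul_rankOne _ _,
    isCompactOperator_of_hasSum hC fun j => (isCompactOperator_rankOne (g j) (g j)).smul _,
    fun j => ?_, fun x hx => ?_⟩
  · refine (happ (g j)).unique ?_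
    convert hasSum_single j fun i hij => ?_
    · simp [inner_self_eq_norm_sq_to_K, hg.1 j]
    · simp [hg.2 hij]
  · refine (happ x).unique ?_
    simp [hx, hasSum_zero]

theorem eigen_of_diagonal {C : E →L[ℂ] E} (hsa : IsSelfAdjoint C) {g : ℕ → E}
    (hg0 : ∀ j, g j ≠ 0) {c : ℕ → ℝ} (hc : Function.Injective c)
    (hCg : ∀ j, C (g j) = (c j : ℂ) • g j) (hC0 : ∀ x, (∀ j, inner ℂ (g j) x = 0) → C x = 0) :
    (∀ z : ℂ, z ≠ 0 → (HasEigenvalue (C : E →ₗ[ℂ] E) z ↔ ∃ n : ℕ, z = (c n : ℂ))) ∧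
    (∀ z : ℂ, z ≠ 0 → HasEigenvalue (C : E →ₗ[ℂ] E) z →
        Module.finrank ℂ (eigenspace (C : E →ₗ[ℂ] E) z) = 1) := by
  have hev (n) : HasEigenvalue (C : E →ₗ[ℂ] E) (c n : ℂ) :=
    hasEigenvalue_of_hasEigenvector (x := g n) ⟨mem_eigenspace_iff.2 (hCg n), hg0 n⟩
  have hinner {z : ℂ} {x : E} (hx : C x = z • x) (j) (hzj : z ≠ c j) : inner ℂ (g j) x = 0 := by
    have := hsa.inner_apply_comm (g j) x
    rw [hCg, hx, inner_smul_left, inner_smul_right, Complex.conj_ofReal] at this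
    have h2 : (z - c j) * inner ℂ (g j) x = 0 := by rw [sub_mul, this, sub_self]
    exact (mul_eq_zero.1 h2).resolve_left (sub_ne_zero.2 hzj)
  have hiff (z : ℂ) (hz : z ≠ 0) :
      HasEigenvalue (C : E →ₗ[ℂ] E) z ↔ ∃ n : ℕ, z = (c n : ℂ) := by
    refine ⟨fun h => ?_, ?_⟩
    · by_contra! hne
      obtain ⟨x, hx⟩ := h.exists_hasEigenvector
      have hCx : C x = z • x := hx.apply_eq_smul
      have h0 := hC0 x fun j => hinner hCx j (hne j)
      rw [hCx] at h0
      exact (smul_ne_zero hz hx.2) h0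
    · rintro ⟨n, rfl⟩
      exact hev n
  refine ⟨hiff, fun z hz h => ?_⟩
  obtain ⟨n, rfl⟩ := (hiff z hz).1 h
  rw [finrank_eq_one_iff']
  refine ⟨⟨g n, mem_eigenspace_iff.2 (hCg n)⟩, fun h0 => hg0 n (congrArg Subtype.val h0), ?_⟩
  rintro ⟨x, hx⟩
  have hCx : C x = (c n : ℂ) • x := mem_eigenspace_iff.1 hx
  have hgn : inner ℂ (g n) (g n) ≠ 0 := inner_self_ne_zero.2 (hg0 n)
  set t := inner ℂ (g n) x / inner ℂ (g n) (g n) with ht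
  refine ⟨t, Subtype.ext ?_⟩
  change t • g n = x
  have hCy : C (x - t • g n) = (c n : ℂ) • (x - t • g n) := by
    rw [map_sub, map_smul, hCx, hCg, smul_sub, smul_comm]
  have h0 := hC0 (x - t • g n) fun j => by
    rcases eq_or_ne j n with rfl | hj
    · rw [inner_sub_right, inner_smul_right, ht, div_mul_cancel₀ _ hgn, sub_self]
    · exact hinner hCy j fun h => hj (hc (Complex.ofReal_injective h)).symm
  rw [hCy] at h0
  exact (sub_eq_zero.1 ((smul_eq_zero.1 h0).resolve_left hz)).symm

theorem exists_isometry_of_orthonormal (e : HilbertBasis ℕ ℂ E) {g : ℕ → E}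
    (hg : Orthonormal ℂ g) :
    ∃ G : E →L[ℂ] E, (∀ j, G (e j) = g j) ∧ ∀ x, ‖G x‖ = ‖x‖ := by
  refine ⟨(hg.orthogonalFamily.linearIsometry.comp
    e.repr.toLinearIsometry).toContinuousLinearMap, fun j => ?_, fun x => ?_⟩
  · change hg.orthogonalFamily.linearIsometry (e.repr (e j)) = g j
    rw [e.repr_self, OrthogonalFamily.linearIsometry_apply_single]
    simp
  · simp

theorem adjoint_apply_self_of_isometry {G : E →L[ℂ] E} (hG : ∀ x, ‖G x‖ = ‖x‖) (x : E) :
    adjoint G (G x) = x := by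
  have := (ContinuousLinearMap.norm_map_iff_adjoint_comp_self G).1 hG
  exact DFunLike.congr_fun this x

theorem inner_ofReal_of_ne {C : E →L[ℂ] E} (hsa : IsSelfAdjoint C) {r s : ℝ} (hrs : r ≠ s)
    {x y : E} (hx : C x = (r : ℂ) • x) (hy : C y = (s : ℂ) • y) : inner ℂ x y = 0 := by
  have := hsa.inner_apply_comm x y
  rw [hx, hy, inner_smul_left, inner_smul_right, Complex.conj_ofReal] at this
  have h2 : ((r : ℂ) - s) * inner ℂ x y = 0 := by rw [sub_mul, this, sub_self]
  exact (mul_eq_zero.1 h2).resolve_left (sub_ne_zero.2 (by exact_mod_cast hrs))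

theorem exists_orthonormal_eigenvectors {C : E →L[ℂ] E} (hsa : IsSelfAdjoint C)
    (hcomp : IsCompactOperator C) {c : ℕ → ℝ} (hc : Function.Injective c) (hc0 : ∀ n, c n ≠ 0)
    (hev : ∀ z : ℂ, z ≠ 0 → (HasEigenvalue (C : E →ₗ[ℂ] E) z ↔ ∃ n : ℕ, z = (c n : ℂ)))
    (hfin : ∀ z : ℂ, z ≠ 0 → HasEigenvalue (C : E →ₗ[ℂ] E) z →
      Module.finrank ℂ (eigenspace (C : E →ₗ[ℂ] E) z) = 1) (v : E) :
    ∃ g : ℕ → E, Orthonormal ℂ g ∧ (∀ j, C (g j) = (c j : ℂ) • g j) ∧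
      (∀ j, ∃ r : ℝ, 0 ≤ r ∧ inner ℂ (g j) v = r) ∧
      ∀ x, (∀ j, inner ℂ (g j) x = 0) → C x = 0 := by
  have hc0' (n) : (c n : ℂ) ≠ 0 := by exact_mod_cast hc0 n
  have key (n) : ∃ x : E, C x = (c n : ℂ) • x ∧ ‖x‖ = 1 ∧
      ∃ r : ℝ, 0 ≤ r ∧ inner ℂ x v = r := by
    obtain ⟨x, hx⟩ := ((hev _ (hc0' n)).2 ⟨n, rfl⟩).exists_hasEigenvector
    have hCx : C x = (c n : ℂ) • x := hx.apply_eq_smul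
    obtain ⟨t, ht, ht'⟩ := exists_norm_smul_eq_one hx.2 v
    exact ⟨t • x, by rw [map_smul, hCx, smul_comm], ht, ht'⟩
  choose g hCg hg1 hgv using key
  refine ⟨g, ⟨hg1, fun i j hij => inner_ofReal_of_ne hsa (hc.ne hij) (hCg i) (hCg j)⟩, hCg, hgv,
    fun x hx => hcomp.apply_eq_zero_of_orthogonal hsa fun z hz v hv => ?_⟩
  rcases eq_or_ne v 0 with rfl | hv0
  · simp
  have hz' : HasEigenvalue (C : E →ₗ[ℂ] E) z :=
    hasEigenvalue_of_hasEigenvector (x := v) ⟨mem_eigenspace_iff.2 hv, hv0⟩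
  obtain ⟨n, rfl⟩ := (hev z hz).1 hz'
  have hgn : (⟨g n, mem_eigenspace_iff.2 (hCg n)⟩ : eigenspace (C : E →ₗ[ℂ] E) (c n)) ≠ 0 :=
    fun h => by simpa [show g n = 0 from congrArg Subtype.val h] using hg1 n
  obtain ⟨t, ht⟩ := (finrank_eq_one_iff_of_nonzero' _ hgn).1 (hfin _ hz hz')
    ⟨v, mem_eigenspace_iff.2 hv⟩
  have ht' : t • g n = v := congrArg Subtype.val ht
  rw [← ht', inner_smul_left, hx, mul_zero]

end Operators

section Uniqueness

open Module.End InnerProductSpace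

variable {E : Type*} [NormedAddCommGroup E] [InnerProductSpace ℂ E] [CompleteSpace E]

section Shift

variable {e : HilbertBasis ℕ ℂ E} {S : E →L[ℂ] E}

theorem inner_basis_succ (hS : ∀ n : ℕ, S (e n) = e (n + 1)) (n : ℕ) (x : E) :
    inner ℂ (e (n + 1)) x = inner ℂ (e n) (adjoint S x) := by
  rw [adjoint_inner_right, hS]

theorem adjoint_shift_basis_zero (hS : ∀ n : ℕ, S (e n) = e (n + 1)) :
    adjoint S (e 0) = 0 :=
  eq_zero_of_inner_hilbertBasis e fun n => by
    rw [← inner_basis_succ hS]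
    exact e.orthonormal.2 (Nat.succ_ne_zero n)

theorem shift_adjoint_apply (hS_iso : ∀ x, ‖S x‖ = ‖x‖) (hS : ∀ n : ℕ, S (e n) = e (n + 1))
    (x : E) : S (adjoint S x) = x - inner ℂ (e 0) x • e 0 := by
  refine ext_inner_hilbertBasis e fun n => ?_
  cases n with
  | zero =>
    rw [← adjoint_inner_left, adjoint_shift_basis_zero hS, inner_zero_left, inner_sub_right,
      inner_smul_right, inner_self_eq_norm_sq_to_K, e.orthonormal.1]
    simp
  | succ n =>
    rw [inner_basis_succ hS, adjoint_apply_self_of_isometry hS_iso, inner_sub_right,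
      inner_smul_right, e.orthonormal.2 (Nat.succ_ne_zero n), mul_zero, sub_zero,
      inner_basis_succ hS]

end Shift

/-- The matrix of a self-adjoint compact Hankel operator in its own eigenbasis. -/
theorem exists_spectral_model {e : HilbertBasis ℕ ℂ E} {S : E →L[ℂ] E}
    (hS_iso : ∀ x, ‖S x‖ = ‖x‖) (hS : ∀ n : ℕ, S (e n) = e (n + 1))
    {lam mu : ℕ → ℝ} (hlam : Function.Injective lam) (hlam0 : ∀ n, lam n ≠ 0)
    (hmu : Function.Injective mu) (hmu0 : ∀ n, mu n ≠ 0)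
    (hne : ∀ j k, lam j ^ 2 ≠ mu k ^ 2)
    {A : E →L[ℂ] E} (hA : ∀ j, A (e j) = (lam j : ℂ) • e j) (hAsa : IsSelfAdjoint A)
    {Γ : E →L[ℂ] E} (hΓ : IsSelfAdjoint Γ) (hcomp : IsCompactOperator Γ)
    (hank : Γ ∘L S = adjoint S ∘L Γ)
    (hev : ∀ z : ℂ, z ≠ 0 → (HasEigenvalue (Γ : E →ₗ[ℂ] E) z ↔ ∃ n : ℕ, z = (lam n : ℂ)))
    (hfin : ∀ z : ℂ, z ≠ 0 → HasEigenvalue (Γ : E →ₗ[ℂ] E) z →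
      Module.finrank ℂ (eigenspace (Γ : E →ₗ[ℂ] E) z) = 1)
    (hev' : ∀ z : ℂ, z ≠ 0 →
      (HasEigenvalue ((Γ ∘L S : E →L[ℂ] E) : E →ₗ[ℂ] E) z ↔ ∃ n : ℕ, z = (mu n : ℂ)))
    (hfin' : ∀ z : ℂ, z ≠ 0 → HasEigenvalue ((Γ ∘L S : E →L[ℂ] E) : E →ₗ[ℂ] E) z →
      Module.finrank ℂ (eigenspace ((Γ ∘L S : E →L[ℂ] E) : E →ₗ[ℂ] E) z) = 1) :
    ∃ (G B : E →L[ℂ] E) (ν : ℕ → ℝ) (f : ℕ → E),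
      Γ = G ∘L A ∘L adjoint G ∧ adjoint S ∘L G ∘L A = G ∘L B ∧
      (∀ j, 0 ≤ ν j) ∧ (∀ j, inner ℂ (e 0) (G (e j)) = ν j) ∧
      Summable (fun j => ν j ^ 2) ∧ ∑' j, ν j ^ 2 ≤ 1 ∧
      (∀ k, HasSum (fun j => lam j ^ 2 * ν j ^ 2 / (lam j ^ 2 - mu k ^ 2)) 1) ∧
      (∀ k, B (f k) = (mu k : ℂ) • f k) ∧
      (∀ k j, inner ℂ (e j) (f k) = ((lam j * ν j / (lam j ^ 2 - mu k ^ 2) : ℝ) : ℂ)) ∧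
      ∀ x, (∀ k, inner ℂ (f k) x = 0) → B x = 0 := by
  have hKcomp : IsCompactOperator (Γ ∘L S) := hcomp.comp_clm S
  have hKsa : IsSelfAdjoint (Γ ∘L S) := by
    rw [ContinuousLinearMap.isSelfAdjoint_iff', adjoint_comp, hank,
      ContinuousLinearMap.isSelfAdjoint_iff'.1 hΓ]
  obtain ⟨g, hg, hΓg, hgν, hΓ0⟩ :=
    exists_orthonormal_eigenvectors hΓ hcomp hlam hlam0 hev hfin (e 0)
  obtain ⟨h, hh, hKh, -, hK0⟩ :=
    exists_orthonormal_eigenvectors hKsa hKcomp hmu hmu0 hev' hfin' (e 0)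
  choose ν hν0 hν using hgν
  obtain ⟨G, hGe, hG⟩ := exists_isometry_of_orthonormal e hg
  have hGG := adjoint_apply_self_of_isometry hG
  have hGsum : Γ = G ∘L A ∘L adjoint G := by
    refine ContinuousLinearMap.ext_of_eqOn_of_orthogonal g (fun j => ?_) fun x hx => ?_
    · simp only [comp_apply]
      rw [hΓg, ← hGe, hGG, hA, map_smul]
    · have h0 : adjoint G x = 0 := eq_zero_of_inner_hilbertBasis e fun j => by
        rw [adjoint_inner_right, hGe, hx]
      simp [h0, hΓ0 x hx]
  have hΓG (x) : Γ x = G (A (adjoint G x)) := DFunLike.congr_fun hGsum x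
  have hKΓ (x) : Γ (S x) = adjoint S (Γ x) := DFunLike.congr_fun hank x
  have hKr (x) : G (adjoint G (Γ (S x))) = Γ (S x) := by
    rw [hΓG, hGG]
  have hGh (k) : G (adjoint G (h k)) = h k := by
    have h1 : Γ (S (h k)) = (mu k : ℂ) • h k := hKh k
    have h2 := hKr (h k)
    rw [h1, map_smul, map_smul] at h2
    exact smul_right_injective _ (by exact_mod_cast hmu0 k : (mu k : ℂ) ≠ 0) h2
  set t : ℕ → ℂ := fun k => inner ℂ (e 0) (Γ (h k)) with ht
  have hrel (k j) : ((lam j : ℂ) ^ 2 - (mu k : ℂ) ^ 2) * inner ℂ (e j) (adjoint G (h k)) =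
      lam j * ν j * t k := by
    have h1 : Γ (S (Γ (S (h k)))) = (mu k : ℂ) • (mu k : ℂ) • h k := by
      have : Γ (S (h k)) = (mu k : ℂ) • h k := hKh k
      rw [this, map_smul, map_smul, this]
    rw [hKΓ (h k), shift_adjoint_apply hS_iso hS] at h1
    have h2 := congrArg (inner ℂ (g j)) h1
    rw [← hΓ.inner_apply_comm, hΓg, inner_smul_left, inner_sub_right, inner_smul_right,
      ← hΓ.inner_apply_comm, hΓg, inner_smul_left, inner_smul_right, inner_smul_right, hν,
      Complex.conj_ofReal] at h2
    rw [adjoint_inner_right, hGe]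
    linear_combination h2
  have hne' (j k) : (lam j : ℂ) ^ 2 - (mu k : ℂ) ^ 2 ≠ 0 := by
    have := sub_ne_zero.2 (hne j k)
    exact_mod_cast this
  have ht0 (k) : t k ≠ 0 := by
    intro h0
    have h1 : adjoint G (h k) = 0 := eq_zero_of_inner_hilbertBasis e fun j => by
      have := hrel k j
      rw [h0, mul_zero] at this
      exact (mul_eq_zero.1 this).resolve_left (hne' j k)
    have h2 := hGh k
    rw [h1, map_zero] at h2
    exact hh.ne_zero k h2.symm
  have hfe (k j) : inner ℂ (e j) ((t k)⁻¹ • adjoint G (h k)) =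
      ((lam j * ν j / (lam j ^ 2 - mu k ^ 2) : ℝ) : ℂ) := by
    rw [inner_smul_right]
    push_cast
    rw [inv_mul_eq_div, div_eq_div_iff (ht0 k) (hne' j k)]
    linear_combination hrel k j
  have hbes := hg.tsum_inner_products_le (e 0)
  have hbes' := hg.inner_products_summable (e 0)
  have hnorm (j) : ‖inner ℂ (g j) (e 0)‖ ^ 2 = ν j ^ 2 := by
    rw [hν, Complex.norm_real, Real.norm_eq_abs, sq_abs]
  simp only [hnorm] at hbes hbes'
  rw [e.orthonormal.1, one_pow] at hbes
  refine ⟨G, adjoint G ∘L Γ ∘L S ∘L G, ν, fun k => (t k)⁻¹ • adjoint G (h k), hGsum, ?_, hν0,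
    fun j => ?_, hbes', hbes, fun k => ?_, fun k => ?_, hfe, fun x hx => ?_⟩
  · ext x
    simp only [comp_apply]
    rw [hKr, hKΓ, hΓG, hGG]
  · rw [hGe, ← inner_conj_symm, hν, Complex.conj_ofReal]
  · rw [← Complex.hasSum_ofReal]
    have h1 := e.hasSum_inner_mul_inner (adjoint G (e 0))
      (A ((t k)⁻¹ • adjoint G (h k)))
    have h2 : inner ℂ (adjoint G (e 0)) (A ((t k)⁻¹ • adjoint G (h k))) = ((1 : ℝ) : ℂ) := by
      rw [map_smul, inner_smul_right, adjoint_inner_left, ← hΓG, Complex.ofReal_one]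
      exact inv_mul_cancel₀ (ht0 k)
    rw [h2] at h1
    refine (congrArg (HasSum · _) (funext fun j => ?_)).mp h1
    rw [← hAsa.inner_apply_comm, hA, inner_smul_left, hfe, adjoint_inner_left, hGe,
      ← inner_conj_symm, hν]
    simp only [Complex.conj_ofReal]
    push_cast
    ring
  · simp only [comp_apply, map_smul, hGh]
    have : Γ (S (h k)) = (mu k : ℂ) • h k := hKh k
    rw [this, map_smul, smul_comm]
  · have h1 : Γ (S (G x)) = 0 := hK0 (G x) fun k => by
      have := hx k
      rw [inner_smul_left, adjoint_inner_left] at this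
      exact (mul_eq_zero.1 this).resolve_left (by simpa using ht0 k)
    simp [h1]

theorem hankel_unique {e : HilbertBasis ℕ ℂ E} {S : E →L[ℂ] E}
    (hS_iso : ∀ x, ‖S x‖ = ‖x‖) (hS : ∀ n : ℕ, S (e n) = e (n + 1))
    {lam mu : ℕ → ℝ} (hint : Interlacing (fun j => lam j ^ 2) (fun k => mu k ^ 2))
    (hlim : Tendsto lam atTop (𝓝 0)) {Γ Γ' : E →L[ℂ] E}
    (hΓ : IsSelfAdjoint Γ ∧ IsCompactOperator Γ ∧ Γ ∘L S = adjoint S ∘L Γ ∧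
      (∀ z : ℂ, z ≠ 0 → (HasEigenvalue (Γ : E →ₗ[ℂ] E) z ↔ ∃ n : ℕ, z = (lam n : ℂ))) ∧
      (∀ z : ℂ, z ≠ 0 → HasEigenvalue (Γ : E →ₗ[ℂ] E) z →
        Module.finrank ℂ (eigenspace (Γ : E →ₗ[ℂ] E) z) = 1) ∧
      (∀ z : ℂ, z ≠ 0 → (HasEigenvalue ((Γ ∘L S : E →L[ℂ] E) : E →ₗ[ℂ] E) z ↔
        ∃ n : ℕ, z = (mu n : ℂ))) ∧
      (∀ z : ℂ, z ≠ 0 → HasEigenvalue ((Γ ∘L S : E →L[ℂ] E) : E →ₗ[ℂ] E) z →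
        Module.finrank ℂ (eigenspace ((Γ ∘L S : E →L[ℂ] E) : E →ₗ[ℂ] E) z) = 1))
    (hΓ' : IsSelfAdjoint Γ' ∧ IsCompactOperator Γ' ∧ Γ' ∘L S = adjoint S ∘L Γ' ∧
      (∀ z : ℂ, z ≠ 0 → (HasEigenvalue (Γ' : E →ₗ[ℂ] E) z ↔ ∃ n : ℕ, z = (lam n : ℂ))) ∧
      (∀ z : ℂ, z ≠ 0 → HasEigenvalue (Γ' : E →ₗ[ℂ] E) z →
        Module.finrank ℂ (eigenspace (Γ' : E →ₗ[ℂ] E) z) = 1) ∧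
      (∀ z : ℂ, z ≠ 0 → (HasEigenvalue ((Γ' ∘L S : E →L[ℂ] E) : E →ₗ[ℂ] E) z ↔
        ∃ n : ℕ, z = (mu n : ℂ))) ∧
      (∀ z : ℂ, z ≠ 0 → HasEigenvalue ((Γ' ∘L S : E →L[ℂ] E) : E →ₗ[ℂ] E) z →
        Module.finrank ℂ (eigenspace ((Γ' ∘L S : E →L[ℂ] E) : E →ₗ[ℂ] E) z) = 1)) :
    Γ = Γ' := by
  have hlam : Function.Injective lam := fun i j h =>
    hint.strictAnti.injective (congrArg (· ^ 2) h)
  have hmu : Function.Injective mu := fun i j h =>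
    hint.strictAnti_right.injective (congrArg (· ^ 2) h)
  have hlam0 (n) : lam n ≠ 0 := fun h => by simpa [h] using hint.pos_left n
  have hmu0 (n) : mu n ≠ 0 := fun h => by simpa [h] using hint.pos n
  obtain ⟨A, hAsa, -, hA, -⟩ := exists_diagonal_operator e.orthonormal hlim
  obtain ⟨h1, h2, h3, h4, h5, h6, h7⟩ := hΓ
  obtain ⟨h1', h2', h3', h4', h5', h6', h7'⟩ := hΓ'
  obtain ⟨G, B, ν, f, hΓe, hSG, hν0, hν, hs, hs1, hsum, hBf, hfe, hB0⟩ :=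
    exists_spectral_model hS_iso hS hlam hlam0 hmu hmu0 hint.ne hA hAsa h1 h2 h3 h4 h5 h6 h7
  obtain ⟨G', B', ν', f', hΓe', hSG', hν0', hν', hs', hs1', hsum', hBf', hfe', hB0'⟩ :=
    exists_spectral_model hS_iso hS hlam hlam0 hmu hmu0 hint.ne hA hAsa
      h1' h2' h3' h4' h5' h6' h7'
  have hdiv (ν : ℕ → ℝ) : (fun j => lam j ^ 2 * ν j ^ 2 / lam j ^ 2) = fun j => ν j ^ 2 :=
    funext fun j => mul_div_cancel_left₀ _ (hint.pos_left j).ne'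
  have hνeq : ν = ν' := by
    funext j
    have hle := hint.weights_le (p := fun j => lam j ^ 2 * ν j ^ 2)
      (p' := fun j => lam j ^ 2 * ν' j ^ 2) (fun j => by positivity) (by rwa [hdiv])
      (by rwa [hdiv]) hsum (fun j => by positivity) hsum' j
    have hle' := hint.weights_le (p := fun j => lam j ^ 2 * ν' j ^ 2)
      (p' := fun j => lam j ^ 2 * ν j ^ 2) (fun j => by positivity) (by rwa [hdiv])
      (by rwa [hdiv]) hsum' (fun j => by positivity) hsum j
    have := mul_left_cancel₀ (hint.pos_left j).ne' (le_antisymm hle hle')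
    exact (pow_left_inj₀ (hν0 j) (hν0' j) two_ne_zero).1 this
  subst hνeq
  have hff : f = f' := funext fun k => ext_inner_hilbertBasis e fun j => by rw [hfe, hfe']
  subst hff
  have hBB : B = B' := ContinuousLinearMap.ext_of_eqOn_of_orthogonal f
    (fun k => by rw [hBf, hBf']) fun x hx => by rw [hB0 x hx, hB0' x hx]
  subst hBB
  have hcoord (n : ℕ) : innerSL ℂ (e n) ∘L G = innerSL ℂ (e n) ∘L G' := by
    induction n with
    | zero =>
      refine ContinuousLinearMap.ext_of_eqOn_of_orthogonal e (fun j => ?_) fun x hx => ?_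
      · simp [hν, hν']
      · simp [eq_zero_of_inner_hilbertBasis e hx]
    | succ n ih =>
      refine ContinuousLinearMap.ext_of_eqOn_of_orthogonal e (fun j => ?_) fun x hx => ?_
      · have hc : (lam j : ℂ) ≠ 0 := by exact_mod_cast hlam0 j
        have hG1 : adjoint S (G (A (e j))) = G (B (e j)) := DFunLike.congr_fun hSG (e j)
        have hG1' : adjoint S (G' (A (e j))) = G' (B (e j)) := DFunLike.congr_fun hSG' (e j)
        have h8 : inner ℂ (e n) (G (B (e j))) = inner ℂ (e n) (G' (B (e j))) :=
          DFunLike.congr_fun ih (B (e j))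
        rw [← hG1, ← hG1', ← inner_basis_succ hS, ← inner_basis_succ hS, hA, map_smul, map_smul,
          inner_smul_right, inner_smul_right] at h8
        exact mul_left_cancel₀ hc h8
      · simp [eq_zero_of_inner_hilbertBasis e hx]
  have hGG : G = G' := ContinuousLinearMap.ext fun x => ext_inner_hilbertBasis e fun n =>
    DFunLike.congr_fun (hcoord n) x
  rw [hΓe, hΓe', hGG]

end Uniqueness

section Contractions

open Module.End InnerProductSpace

variable {E : Type*} [NormedAddCommGroup E] [InnerProductSpace ℂ E]

theorem exists_of_sum_sq_le (e : HilbertBasis ℕ ℂ E) {s : ℕ → ℂ} {C : ℝ} (hC : 0 ≤ C)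
    (hs : ∀ N, ∑ n ∈ Finset.range N, ‖s n‖ ^ 2 ≤ C ^ 2) :
    ∃ x : E, ‖x‖ ≤ C ∧ ∀ n, inner ℂ (e n) x = s n := by
  have hs' (t : Finset ℕ) : ∑ n ∈ t, ‖s n‖ ^ (2 : ENNReal).toReal ≤ C ^ (2 : ENNReal).toReal := by
    obtain ⟨N, hN⟩ := t.exists_nat_subset_range
    simp only [ENNReal.toReal_ofNat, Real.rpow_ofNat]
    exact (Finset.sum_le_sum_of_subset_of_nonneg hN fun _ _ _ => by positivity).trans (hs N)
  let y : lp (fun _ : ℕ => ℂ) 2 := ⟨s, memℓp_gen' hs'⟩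
  refine ⟨e.repr.symm y, ?_, fun n => ?_⟩
  · rw [LinearIsometryEquiv.norm_map]
    exact lp.norm_le_of_forall_sum_le (by simp) hC hs'
  · rw [← e.repr_apply_apply, LinearIsometryEquiv.apply_symm_apply]

theorem exists_analysis_operator (e : HilbertBasis ℕ ℂ E) (l : ℕ → E →L[ℂ] ℂ)
    (hl : ∀ x N, ∑ n ∈ Finset.range N, ‖l n x‖ ^ 2 ≤ ‖x‖ ^ 2) :
    ∃ W : E →L[ℂ] E, ∀ n x, inner ℂ (e n) (W x) = l n x := by
  choose W hW1 hW2 using fun x => exists_of_sum_sq_le e (norm_nonneg x) (hl x)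
  refine ⟨LinearMap.mkContinuous ⟨⟨W, fun x y => ?_⟩, fun c x => ?_⟩ 1 fun x => ?_,
    fun n x => hW2 x n⟩
  · exact ext_inner_hilbertBasis e fun n => by simp [hW2]
  · exact ext_inner_hilbertBasis e fun n => by simp [hW2]
  · simpa using hW1 x

theorem eq_of_re_inner_eq {x y : E} (h : ‖x‖ ≤ ‖y‖) (h' : (inner ℂ x y).re = ‖y‖ ^ 2) : x = y := by
  have h1 := norm_sub_sq (𝕜 := ℂ) x y
  have h2 : RCLike.re (inner ℂ x y) = ‖y‖ ^ 2 := h'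
  rw [h2] at h1
  have h3 : ‖x‖ ^ 2 ≤ ‖y‖ ^ 2 := by gcongr
  have h4 : ‖x - y‖ ^ 2 ≤ 0 := by linarith
  have h5 : ‖x - y‖ = 0 := by
    have := sq_nonneg ‖x - y‖
    exact pow_eq_zero_iff two_ne_zero |>.1 (le_antisymm h4 this)
  exact sub_eq_zero.1 (norm_eq_zero.1 h5)

variable [CompleteSpace E]

theorem exists_eigenvalue_norm_eq {R : E →L[ℂ] E} (hR : IsSelfAdjoint R)
    (hc : IsCompactOperator R) (hR0 : R ≠ 0) :
    ∃ z : ℂ, ‖z‖ = ‖R‖ ∧ z ≠ 0 ∧ HasEigenvalue (R : E →ₗ[ℂ] E) z := by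
  have : Nontrivial (E →L[ℂ] E) := ⟨R, 0, hR0⟩
  obtain ⟨z, hz, hz'⟩ := spectrum.exists_nnnorm_eq_spectralRadius R
  rw [hR.spectralRadius_eq_nnnorm, ENNReal.coe_inj] at hz'
  have hz'' : ‖z‖ = ‖R‖ := congrArg NNReal.toReal hz'
  have hz0 : z ≠ 0 := norm_ne_zero_iff.1 (hz''.trans_ne (norm_ne_zero_iff.2 hR0))
  exact ⟨z, hz'', hz0, (hc.hasEigenvalue_iff_mem_spectrum hz0).2 hz⟩

theorem norm_adjoint_apply_le {T : E →L[ℂ] E} (hT : ∀ x, ‖T x‖ ≤ ‖x‖) (x : E) :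
    ‖adjoint T x‖ ≤ ‖x‖ := by
  have h1 : ‖T‖ ≤ 1 := T.opNorm_le_bound zero_le_one (by simpa using hT)
  calc ‖adjoint T x‖ ≤ ‖adjoint T‖ * ‖x‖ := le_opNorm _ _
    _ = ‖T‖ * ‖x‖ := by rw [LinearIsometryEquiv.norm_map]
    _ ≤ 1 * ‖x‖ := by gcongr
    _ = ‖x‖ := one_mul _

theorem apply_eq_of_adjoint_apply_eq {T : E →L[ℂ] E} (hT : ∀ x, ‖T x‖ ≤ ‖x‖) {ζ : ℂ}
    (hζ : ‖ζ‖ = 1) {x : E} (hx : adjoint T x = ζ • x) : T x = (starRingEnd ℂ) ζ • x := by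
  refine eq_of_re_inner_eq ?_ ?_
  · rw [norm_smul, RCLike.norm_conj, hζ, one_mul]
    exact hT x
  · rw [← adjoint_inner_right, map_smul, hx, smul_smul, Complex.conj_mul', hζ, norm_smul,
      RCLike.norm_conj, hζ]
    simp [inner_self_eq_norm_sq_to_K, ← Complex.ofReal_pow]

/-- A compact self-adjoint solution of `T R T* = R` vanishes if the contraction `T` has no
unimodular eigenvalue. -/
theorem eq_zero_of_conj_eq {R T : E →L[ℂ] E} (hR : IsSelfAdjoint R) (hc : IsCompactOperator R)
    (hT : ∀ x, ‖T x‖ ≤ ‖x‖) (h : ∀ x, T (R (adjoint T x)) = R x)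
    (hno : ∀ (ζ : ℂ) (x : E), ‖ζ‖ = 1 → T x = ζ • x → x = 0) : R = 0 := by
  by_contra hR0
  obtain ⟨z, hz, hz0, hev⟩ := exists_eigenvalue_norm_eq hR hc hR0
  have hzpos : 0 < ‖R‖ := norm_pos_iff.2 hR0
  have hT' := norm_adjoint_apply_le hT
  have key (x : E) (hx : R x = z • x) :
      ‖adjoint T x‖ = ‖x‖ ∧ R (adjoint T x) = z • adjoint T x := by
    have h1 : inner ℂ (R (adjoint T x)) (adjoint T x) = (starRingEnd ℂ) z * (‖x‖ : ℂ) ^ 2 := by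
      rw [adjoint_inner_right, h, hx, inner_smul_left, inner_self_eq_norm_sq_to_K]
      rfl
    have h2 : ‖adjoint T x‖ = ‖x‖ := by
      refine le_antisymm (hT' x) ?_
      have h3 := norm_inner_le_norm (𝕜 := ℂ) (R (adjoint T x)) (adjoint T x)
      rw [h1, norm_mul, RCLike.norm_conj, hz, norm_pow, Complex.norm_real, norm_norm] at h3
      have h4 := h3.trans (mul_le_mul_of_nonneg_right (R.le_opNorm _) (norm_nonneg _))
      rw [mul_assoc] at h4
      have h5 := le_of_mul_le_mul_left h4 hzpos
      rw [← sq] at h5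
      exact (pow_le_pow_iff_left₀ (norm_nonneg _) (norm_nonneg _) two_ne_zero).1 h5
    refine ⟨h2, eq_of_re_inner_eq ?_ ?_⟩
    · rw [norm_smul, hz]
      exact R.le_opNorm _
    · rw [inner_smul_right, h1, ← mul_assoc, Complex.mul_conj', norm_smul, h2]
      norm_cast
      ring
  set V := eigenspace (R : E →ₗ[ℂ] E) z with hV
  have hinv : ∀ x ∈ V, (adjoint T : E →ₗ[ℂ] E) x ∈ V := fun x hx =>
    mem_eigenspace_iff.2 (key x (mem_eigenspace_iff.1 hx)).2
  have hfd : FiniteDimensional ℂ V := ContinuousLinearMap.finite_dimensional_eigenspace hc z hz0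
  have hnt : Nontrivial V := Submodule.nontrivial_iff_ne_bot.2 hev
  obtain ⟨ζ, hζ⟩ := Module.End.exists_eigenvalue ((adjoint T : E →ₗ[ℂ] E).restrict hinv)
  obtain ⟨x, hx⟩ := hζ.exists_hasEigenvector
  have hx1 : adjoint T (x : E) = ζ • (x : E) := congrArg Subtype.val hx.apply_eq_smul
  have hx0 : (x : E) ≠ 0 := fun h0 => hx.2 (Subtype.ext h0)
  have hζ1 : ‖ζ‖ = 1 := by
    have := (key x (mem_eigenspace_iff.1 x.2)).1
    rw [hx1, norm_smul] at this
    exact mul_right_cancel₀ (norm_ne_zero_iff.2 hx0) (this.trans (one_mul _).symm)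
  exact hx0 (hno _ _ (by rw [RCLike.norm_conj, hζ1]) (apply_eq_of_adjoint_apply_eq hT hζ1 hx1))

theorem eq_zero_of_tsum_pow_mul_eq_zero {a : ℕ → ℝ} (ha : StrictAnti a) (ha0 : ∀ j, 0 < a j)
    {s : ℕ → ℂ} (hs : Summable fun j => ‖s j‖) (h : ∀ n : ℕ, ∑' j, (a j : ℂ) ^ n * s j = 0)
    (j : ℕ) : s j = 0 := by
  induction j using Nat.strong_induction_on with
  | _ m ih =>
  have hlim : Tendsto (fun n : ℕ => ∑' j, ((a j / a m : ℝ) : ℂ) ^ n * s j) atTop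
      (𝓝 (∑' j, if j = m then s j else 0)) := by
    refine tendsto_tsum_of_dominated_convergence hs (fun j => ?_) (.of_forall fun n j => ?_)
    · rcases lt_trichotomy j m with hj | rfl | hj
      · simp [ih j hj, hj.ne]
      · simp [(ha0 j).ne']
      · rw [if_neg hj.ne']
        have h1 : ‖((a j / a m : ℝ) : ℂ)‖ < 1 := by
          rw [Complex.norm_real, Real.norm_of_nonneg (div_pos (ha0 j) (ha0 m)).le,
            div_lt_one (ha0 m)]
          exact ha hj
        simpa using (tendsto_pow_atTop_nhds_zero_of_norm_lt_one h1).mul_const (s j)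
    · rcases lt_or_ge j m with hj | hj
      · simp [ih j hj]
      · rw [norm_mul, norm_pow, Complex.norm_real,
          Real.norm_of_nonneg (div_pos (ha0 j) (ha0 m)).le]
        refine mul_le_of_le_one_left (norm_nonneg _) (pow_le_one₀ (div_pos (ha0 j) (ha0 m)).le ?_)
        exact (div_le_one (ha0 m)).2 (ha.antitone hj)
  have hzero (n : ℕ) : ∑' j, ((a j / a m : ℝ) : ℂ) ^ n * s j = 0 := by
    have : (fun j => ((a j / a m : ℝ) : ℂ) ^ n * s j) =
        fun j => ((a m : ℂ) ^ n)⁻¹ * ((a j : ℂ) ^ n * s j) := by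
      funext j
      push_cast
      rw [div_pow]
      ring
    rw [this, tsum_mul_left, h, mul_zero]
  simp only [hzero, tsum_ite_eq] at hlim
  exact (tendsto_const_nhds_iff.1 hlim).symm

end Contractions

section Existence

open Module.End InnerProductSpace

variable {E : Type*} [NormedAddCommGroup E] [InnerProductSpace ℂ E]

theorem diagonal_denseRange {e : HilbertBasis ℕ ℂ E} {c : ℕ → ℝ} (hc : ∀ j, c j ≠ 0)
    {A : E →L[ℂ] E} (hA : ∀ j, A (e j) = (c j : ℂ) • e j) : DenseRange (A : E →ₗ[ℂ] E) := by
  have hle : Submodule.span ℂ (Set.range e) ≤ LinearMap.range (A : E →ₗ[ℂ] E) := by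
    refine Submodule.span_le.2 ?_
    rintro _ ⟨j, rfl⟩
    have hcj : (c j : ℂ) ≠ 0 := by exact_mod_cast hc j
    refine ⟨(c j : ℂ)⁻¹ • e j, ?_⟩
    rw [map_smul, ContinuousLinearMap.coe_coe, hA, smul_smul, inv_mul_cancel₀ hcj, one_smul]
  have hd : Dense (Submodule.span ℂ (Set.range e) : Set E) := by
    rw [Submodule.dense_iff_topologicalClosure_eq_top, e.dense_span]
  exact hd.mono hle

variable [CompleteSpace E]

theorem inner_basis_diagonal {e : HilbertBasis ℕ ℂ E} {c : ℕ → ℝ} {A : E →L[ℂ] E}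
    (hA : ∀ j, A (e j) = (c j : ℂ) • e j) (hAsa : IsSelfAdjoint A) (j : ℕ) (x : E) :
    inner ℂ (e j) (A x) = c j * inner ℂ (e j) x := by
  rw [← hAsa.inner_apply_comm, hA, inner_smul_left, Complex.conj_ofReal]

theorem diagonal_injective {e : HilbertBasis ℕ ℂ E} {c : ℕ → ℝ} (hc : ∀ j, c j ≠ 0)
    {A : E →L[ℂ] E} (hA : ∀ j, A (e j) = (c j : ℂ) • e j) (hAsa : IsSelfAdjoint A) {x y : E}
    (h : A x = A y) : x = y :=
  ext_inner_hilbertBasis e fun j => by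
    have := congrArg (inner ℂ (e j)) h
    rw [inner_basis_diagonal hA hAsa, inner_basis_diagonal hA hAsa] at this
    exact mul_left_cancel₀ (by exact_mod_cast hc j) this

theorem IsSelfAdjoint.conj_eigenvalue {C : E →L[ℂ] E} (hC : IsSelfAdjoint C) {z : ℂ} {x : E}
    (hx : C x = z • x) (hx0 : x ≠ 0) : ∃ r : ℝ, z = r := by
  have h1 := hC.inner_apply_comm x x
  rw [hx, inner_smul_left, inner_smul_right] at h1
  exact Complex.conj_eq_iff_real.1 (mul_right_cancel₀ (inner_self_ne_zero.2 hx0) h1)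

/-- Eigenvectors for non-zero eigenvalues of the rank one perturbation `A² - ⟨A w, ·⟩ A w`. -/
theorem eigenvector_rank_one_perturbation {e : HilbertBasis ℕ ℂ E} {lam mu ν : ℕ → ℝ}
    (hint : Interlacing (fun j => lam j ^ 2) (fun k => mu k ^ 2)) (hν0 : ∀ j, 0 < ν j)
    (hs : Summable fun j => ν j ^ 2) (hs1 : ∑' j, ν j ^ 2 ≤ 1)
    (hsum : ∀ k, HasSum (fun j => lam j ^ 2 * ν j ^ 2 / (lam j ^ 2 - mu k ^ 2)) 1)
    {A : E →L[ℂ] E} (hA : ∀ j, A (e j) = (lam j : ℂ) • e j) (hAsa : IsSelfAdjoint A)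
    {w : E} (hw : ∀ j, inner ℂ (e j) w = ν j)
    {φ : ℕ → E} (hφ : ∀ k j, inner ℂ (e j) (φ k) =
      ((lam j * ν j / (lam j ^ 2 - mu k ^ 2) : ℝ) : ℂ))
    {z : ℝ} (hz : z ≠ 0) {v : E} (hv0 : v ≠ 0)
    (hv : A (A v) - inner ℂ (A w) v • A w = (z : ℂ) • v) :
    ∃ k, ∃ t : ℂ, v = t • φ k := by
  have hlam0 (n) : lam n ≠ 0 := fun h => by simpa [h] using hint.pos_left n
  have hAe := inner_basis_diagonal hA hAsa
  set t := inner ℂ (A w) v with ht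
  have hrel (j) : ((lam j : ℂ) ^ 2 - z) * inner ℂ (e j) v = t * (lam j * ν j) := by
    have := congrArg (inner ℂ (e j)) hv
    rw [inner_sub_right, inner_smul_right, inner_smul_right, hAe, hAe, hAe, hw] at this
    linear_combination this
  have hts : HasSum (fun j => (lam j * ν j : ℂ) * inner ℂ (e j) v) t := by
    refine (congrArg (HasSum · _) (funext fun j => ?_)).mp (e.hasSum_inner_mul_inner (A w) v)
    rw [← inner_conj_symm, hAe, hw, map_mul, Complex.conj_ofReal, Complex.conj_ofReal]
  have hpos (j) : (lam j * ν j : ℂ) ≠ 0 := by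
    exact_mod_cast mul_ne_zero (hlam0 j) (hν0 j).ne'
  have ht0 : t ≠ 0 := by
    intro h0
    obtain ⟨i, hi⟩ : ∃ i, inner ℂ (e i) v ≠ 0 := by
      by_contra! hall
      exact hv0 (eq_zero_of_inner_hilbertBasis e hall)
    have hzi : (lam i : ℂ) ^ 2 - z = 0 := by
      have := hrel i
      rw [h0, zero_mul] at this
      exact (mul_eq_zero.1 this).resolve_right hi
    have hother (j) (hj : j ≠ i) : inner ℂ (e j) v = 0 := by
      have := hrel j
      rw [h0, zero_mul] at this
      refine (mul_eq_zero.1 this).resolve_left fun h1 => hj ?_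
      refine hint.strictAnti.injective (?_ : lam j ^ 2 = lam i ^ 2)
      have h2 : (lam j : ℂ) ^ 2 = (lam i : ℂ) ^ 2 := by linear_combination h1 - hzi
      exact_mod_cast h2
    have h3 := hts.unique (hasSum_single i fun j hj => by rw [hother j hj, mul_zero])
    rw [h0] at h3
    exact mul_ne_zero (hpos i) hi h3.symm
  have hza (j) : lam j ^ 2 ≠ z := by
    intro h1
    have := hrel j
    rw [← h1] at this
    push_cast at this
    rw [sub_self, zero_mul] at this
    exact mul_ne_zero ht0 (hpos j) this.symm
  have hza' (j) : (lam j : ℂ) ^ 2 - z ≠ 0 := by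
    have := sub_ne_zero.2 (hza j)
    exact_mod_cast this
  have hvj (j) : inner ℂ (e j) v = t * ((lam j * ν j / (lam j ^ 2 - z) : ℝ) : ℂ) := by
    push_cast
    rw [← mul_div_assoc, eq_div_iff (hza' j), mul_comm, hrel]
  have hone : HasSum (fun j => lam j ^ 2 * ν j ^ 2 / (lam j ^ 2 - z)) 1 := by
    rw [← Complex.hasSum_ofReal]
    refine (congrArg₂ HasSum (funext fun j => ?_) ?_).mp (hts.mul_left t⁻¹)
    · rw [hvj]
      push_cast
      field_simp
    · rw [inv_mul_cancel₀ ht0, Complex.ofReal_one]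
  have hdiv : (fun j => lam j ^ 2 * ν j ^ 2 / lam j ^ 2) = fun j => ν j ^ 2 :=
    funext fun j => mul_div_cancel_left₀ _ (hint.pos_left j).ne'
  obtain ⟨k, hk⟩ := hint.exists_eq_right (p := fun j => lam j ^ 2 * ν j ^ 2)
    (fun j => mul_pos (hint.pos_left j) (by have := hν0 j; positivity)) (by rwa [hdiv])
    (by rwa [hdiv]) hsum hz hza hone
  refine ⟨k, t, ext_inner_hilbertBasis e fun j => ?_⟩
  rw [hvj, inner_smul_right, hφ, hk]

theorem exists_square_root {e : HilbertBasis ℕ ℂ E} {lam mu ν : ℕ → ℝ}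
    (hint : Interlacing (fun j => lam j ^ 2) (fun k => mu k ^ 2)) (hlim : Tendsto lam atTop (𝓝 0))
    (hlim' : Tendsto mu atTop (𝓝 0)) (hν0 : ∀ j, 0 < ν j)
    (hs : Summable fun j => ν j ^ 2) (hs1 : ∑' j, ν j ^ 2 ≤ 1)
    (hsum : ∀ k, HasSum (fun j => lam j ^ 2 * ν j ^ 2 / (lam j ^ 2 - mu k ^ 2)) 1)
    {A : E →L[ℂ] E} (hA : ∀ j, A (e j) = (lam j : ℂ) • e j) (hAsa : IsSelfAdjoint A)
    (hAc : IsCompactOperator A) {w : E} (hw : ∀ j, inner ℂ (e j) w = ν j) :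
    ∃ (B : E →L[ℂ] E) (f : ℕ → E), IsSelfAdjoint B ∧ (∀ k, f k ≠ 0) ∧
      (∀ k, B (f k) = (mu k : ℂ) • f k) ∧ (∀ x, (∀ k, inner ℂ (f k) x = 0) → B x = 0) ∧
      ∀ x, B (B x) = A (A x) - inner ℂ (A w) x • A w := by
  have hAe := inner_basis_diagonal hA hAsa
  have hex (k) : ∃ φ : E, ∀ j, inner ℂ (e j) φ =
      ((lam j * ν j / (lam j ^ 2 - mu k ^ 2) : ℝ) : ℂ) := by
    have h1 : Tendsto (fun j => lam j / (lam j ^ 2 - mu k ^ 2)) atTop (𝓝 0) := by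
      have := hlim.div (hint.tendsto.sub_const (mu k ^ 2)) (by
        rw [zero_sub, neg_ne_zero]
        exact (hint.pos k).ne')
      rw [zero_div] at this
      exact this
    obtain ⟨C, hCsa, -, hC, -⟩ := exists_diagonal_operator e.orthonormal h1
    refine ⟨C w, fun j => ?_⟩
    rw [inner_basis_diagonal hC hCsa, hw]
    push_cast
    ring
  choose φ hφ using hex
  have hne (j k) : (lam j : ℂ) ^ 2 - (mu k : ℂ) ^ 2 ≠ 0 := by
    have := sub_ne_zero.2 (hint.ne j k)
    exact_mod_cast this
  have huφ (k) : inner ℂ (A w) (φ k) = 1 := by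
    refine (e.hasSum_inner_mul_inner (A w) (φ k)).unique ?_
    have h1 := Complex.hasSum_ofReal.2 (hsum k)
    rw [Complex.ofReal_one] at h1
    refine (congrArg (HasSum · _) (funext fun j => ?_)).mp h1
    rw [← inner_conj_symm, hAe, hw, map_mul, Complex.conj_ofReal, Complex.conj_ofReal, hφ]
    push_cast
    ring
  have hφ0 (k) : φ k ≠ 0 := fun h => by simpa [h] using huφ k
  set D : E →L[ℂ] E := A ∘L A - rankOne ℂ (A w) (A w) with hD
  have hDapp (x) : D x = A (A x) - inner ℂ (A w) x • A w := rfl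
  have hDsa : IsSelfAdjoint D := by
    refine IsSelfAdjoint.sub ?_ (isSelfAdjoint_rankOne_self _)
    rw [ContinuousLinearMap.isSelfAdjoint_iff', adjoint_comp,
      ContinuousLinearMap.isSelfAdjoint_iff'.1 hAsa]
  have hDc : IsCompactOperator D := (hAc.comp_clm A).sub (isCompactOperator_rankOne _ _)
  have hDφ (k) : D (φ k) = ((mu k ^ 2 : ℝ) : ℂ) • φ k := by
    refine ext_inner_hilbertBasis e fun j => ?_
    rw [hDapp, huφ, one_smul, inner_sub_right, inner_smul_right, hAe, hAe, hAe, hφ, hw]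
    have := hne j k
    push_cast
    field_simp
    ring
  set f : ℕ → E := fun k => (‖φ k‖ : ℂ)⁻¹ • φ k with hf
  have hfo : Orthonormal ℂ f := by
    refine ⟨fun k => ?_, fun i j hij => ?_⟩
    · simp [hf, norm_smul, hφ0 k]
    · change inner ℂ ((‖φ i‖ : ℂ)⁻¹ • φ i) ((‖φ j‖ : ℂ)⁻¹ • φ j) = 0
      rw [inner_smul_left, inner_smul_right, inner_ofReal_of_ne hDsa
        (hint.strictAnti_right.injective.ne hij) (hDφ i) (hDφ j), mul_zero, mul_zero]
  obtain ⟨B, hBsa, -, hB, hB0⟩ := exists_diagonal_operator hfo hlim'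
  have hBD : B ∘L B = D := by
    refine ContinuousLinearMap.ext_of_eqOn_of_orthogonal f (fun k => ?_) fun x hx => ?_
    · rw [comp_apply, hB, map_smul, hB, smul_smul]
      simp only [hf]
      rw [map_smul, hDφ, smul_comm]
      push_cast
      rw [sq]
    · rw [comp_apply, hB0 x hx, map_zero]
      refine (hDc.apply_eq_zero_of_orthogonal hDsa fun z hz v hv => ?_).symm
      rcases eq_or_ne v 0 with rfl | hv0
      · simp
      obtain ⟨r, rfl⟩ := hDsa.conj_eigenvalue hv hv0
      obtain ⟨k, t, rfl⟩ := eigenvector_rank_one_perturbation hint hν0 hs hs1 hsum hA hAsa hw hφ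
        (by exact_mod_cast hz) hv0 hv
      have h1 := hx k
      rw [hf, inner_smul_left] at h1
      rw [inner_smul_left, (mul_eq_zero.1 h1).resolve_left (by simpa using hφ0 k), mul_zero]
  exact ⟨B, f, hBsa, hfo.ne_zero, hB, hB0, fun x => DFunLike.congr_fun hBD x⟩

/-- The contraction `T` with `T A = B`, where `B² = A² - ⟨A w, ·⟩ A w`. -/
theorem exists_contraction {e : HilbertBasis ℕ ℂ E} {lam : ℕ → ℝ} (hlam0 : ∀ j, lam j ≠ 0)
    {A B : E →L[ℂ] E} (hA : ∀ j, A (e j) = (lam j : ℂ) • e j) (hAsa : IsSelfAdjoint A)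
    (hBsa : IsSelfAdjoint B) {w : E}
    (hBB : ∀ x, B (B x) = A (A x) - inner ℂ (A w) x • A w) :
    ∃ T : E →L[ℂ] E, (∀ x, T (A x) = B x) ∧ (∀ x, A (adjoint T x) = B x) ∧
      ∀ x, adjoint T (T x) = x - inner ℂ w x • w := by
  have hd := diagonal_denseRange hlam0 hA
  have hnorm (x : E) : ‖B x‖ ≤ 1 * ‖A x‖ := by
    rw [one_mul]
    have h1 : inner ℂ (B x) (B x) =
        inner ℂ (A x) (A x) - inner ℂ (A w) x * (starRingEnd ℂ) (inner ℂ (A w) x) := by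
      rw [hBsa.inner_apply_comm, hBB, inner_sub_right, inner_smul_right, hAsa.inner_apply_comm x,
        inner_conj_symm]
    rw [inner_self_eq_norm_sq_to_K, inner_self_eq_norm_sq_to_K, Complex.mul_conj'] at h1
    have h2 : ‖B x‖ ^ 2 = ‖A x‖ ^ 2 - ‖inner ℂ (A w) x‖ ^ 2 := by
      apply Complex.ofReal_injective
      push_cast
      exact h1
    refine (pow_le_pow_iff_left₀ (norm_nonneg _) (norm_nonneg _) two_ne_zero).1 ?_
    rw [h2]
    exact sub_le_self _ (by positivity)
  set T := (B : E →ₗ[ℂ] E).extendOfNorm (A : E →ₗ[ℂ] E) with hT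
  have hTA (x : E) : T (A x) = B x := LinearMap.extendOfNorm_eq hd ⟨1, hnorm⟩ x
  have hAT (x : E) : A (adjoint T x) = B x :=
    ext_inner_left ℂ fun y => by
      rw [← hAsa.inner_apply_comm, adjoint_inner_right, hTA, hBsa.inner_apply_comm]
  refine ⟨T, hTA, hAT, fun x => diagonal_injective hlam0 hA hAsa ?_⟩
  have hTT : A ∘L adjoint T ∘L T = A - rankOne ℂ (A w) w := by
    refine ContinuousLinearMap.ext_of_eqOn_of_orthogonal e (fun j => ?_) fun x hx => ?_
    · have hc : (lam j : ℂ) ≠ 0 := by exact_mod_cast hlam0 j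
      have h1 : (A ∘L adjoint T ∘L T) (A (e j)) = (A - rankOne ℂ (A w) w) (A (e j)) := by
        simp only [comp_apply, sub_apply, rankOne_apply]
        rw [hAT, hTA, hBB, hAsa.inner_apply_comm]
      rw [hA, map_smul, map_smul] at h1
      exact smul_right_injective _ hc h1
    · simp [eq_zero_of_inner_hilbertBasis e hx]
  have := DFunLike.congr_fun hTT x
  simp only [comp_apply, sub_apply, rankOne_apply] at this
  rw [this, map_sub, map_smul]

end Existence

section Construction

open Module.End InnerProductSpace

variable {E : Type*} [NormedAddCommGroup E] [InnerProductSpace ℂ E] [CompleteSpace E]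

theorem norm_sq_of_adjoint_apply {T : E →L[ℂ] E} {w : E}
    (hTT : ∀ x, adjoint T (T x) = x - inner ℂ w x • w) (x : E) :
    ‖T x‖ ^ 2 = ‖x‖ ^ 2 - ‖inner ℂ w x‖ ^ 2 := by
  have h1 : inner ℂ (T x) (T x) = inner ℂ x x - inner ℂ w x * (starRingEnd ℂ) (inner ℂ w x) := by
    rw [← adjoint_inner_right, hTT, inner_sub_right, inner_smul_right, inner_conj_symm]
  rw [inner_self_eq_norm_sq_to_K, inner_self_eq_norm_sq_to_K, Complex.mul_conj'] at h1
  apply Complex.ofReal_injective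
  push_cast
  exact h1

theorem sum_norm_inner_pow_le {T : E →L[ℂ] E} {w : E}
    (hTT : ∀ x, adjoint T (T x) = x - inner ℂ w x • w) (x : E) (N : ℕ) :
    ∑ n ∈ Finset.range N, ‖inner ℂ w ((T ^ n) x)‖ ^ 2 ≤ ‖x‖ ^ 2 := by
  have h1 : ∑ n ∈ Finset.range N, ‖inner ℂ w ((T ^ n) x)‖ ^ 2 = ‖x‖ ^ 2 - ‖(T ^ N) x‖ ^ 2 := by
    induction N with
    | zero => simp
    | succ N ih =>
      rw [Finset.sum_range_succ, ih, pow_succ' T N, mul_apply_eq_comp,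
        norm_sq_of_adjoint_apply hTT]
      ring
  rw [h1]
  exact sub_le_self _ (by positivity)

theorem eq_zero_of_inner_pow_eq_zero {e : HilbertBasis ℕ ℂ E} {lam ν : ℕ → ℝ}
    (hanti : StrictAnti fun j => lam j ^ 2) (hpos : ∀ j, 0 < lam j ^ 2) (hν0 : ∀ j, 0 < ν j)
    {A : E →L[ℂ] E} (hA : ∀ j, A (e j) = (lam j : ℂ) • e j) (hAsa : IsSelfAdjoint A)
    {w : E} (hw : ∀ j, inner ℂ (e j) w = ν j) {y : E}
    (hy : ∀ n : ℕ, inner ℂ w ((A ^ n) y) = 0) : y = 0 := by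
  have hpow (n j) : inner ℂ (e j) ((A ^ n) y) = (lam j : ℂ) ^ n * inner ℂ (e j) y := by
    induction n with
    | zero => simp
    | succ n ih =>
      rw [pow_succ' A n, mul_apply_eq_comp, inner_basis_diagonal hA hAsa, ih]
      ring
  have hwe (j) : inner ℂ w (e j) = ν j := by
    rw [← inner_conj_symm, hw, Complex.conj_ofReal]
  refine eq_zero_of_inner_hilbertBasis e fun j => ?_
  have h1 := eq_zero_of_tsum_pow_mul_eq_zero (s := fun j => ν j * inner ℂ (e j) y) hanti hpos
    ?_ (fun n => ?_) j
  · exact (mul_eq_zero.1 h1).resolve_left (by exact_mod_cast (hν0 j).ne')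
  · have := (e.summable_inner_mul_inner w y).norm
    simpa only [hwe] using this
  · have := e.tsum_inner_mul_inner w ((A ^ (2 * n)) y)
    rw [hy] at this
    rw [← this]
    refine tsum_congr fun j => ?_
    rw [hwe, hpow, pow_mul]
    push_cast
    ring

theorem contraction_no_unimodular_eigenvalue {A B T : E →L[ℂ] E} {w : E}
    (hTA : ∀ x, T (A x) = B x) (hAT : ∀ x, A (adjoint T x) = B x)
    (hTT : ∀ x, adjoint T (T x) = x - inner ℂ w x • w)
    (hcyc : ∀ y : E, (∀ n : ℕ, inner ℂ w ((A ^ n) y) = 0) → y = 0) (ζ : ℂ) (y : E)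
    (hζ : ‖ζ‖ = 1) (hy : T y = ζ • y) : y = 0 := by
  have hζ0 : ζ ≠ 0 := norm_ne_zero_iff.1 (by rw [hζ]; exact one_ne_zero)
  refine hcyc y fun n => ?_
  induction n generalizing ζ y with
  | zero =>
    have := norm_sq_of_adjoint_apply hTT y
    rw [hy, norm_smul, hζ, one_mul] at this
    have h1 : ‖inner ℂ w y‖ ^ 2 = 0 := by linarith
    simpa using h1
  | succ n ih =>
    have h0 : inner ℂ w y = 0 := by
      have := norm_sq_of_adjoint_apply hTT y
      rw [hy, norm_smul, hζ, one_mul] at this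
      have h1 : ‖inner ℂ w y‖ ^ 2 = 0 := by linarith
      simpa using h1
    have h1 : ζ • adjoint T y = y := by
      have := hTT y
      rwa [hy, map_smul, h0, zero_smul, sub_zero] at this
    have h2 : T (A y) = ζ⁻¹ • A y := by
      conv_rhs => rw [← h1]
      rw [hTA, ← hAT, map_smul, smul_smul, inv_mul_cancel₀ hζ0, one_smul]
    rw [pow_succ A n, mul_apply_eq_comp]
    exact ih ζ⁻¹ (A y) (by rw [norm_inv, hζ, inv_one]) h2 (inv_ne_zero hζ0)

theorem exists_hankel {e : HilbertBasis ℕ ℂ E} {S : E →L[ℂ] E}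
    (hS_iso : ∀ x, ‖S x‖ = ‖x‖) (hS : ∀ n : ℕ, S (e n) = e (n + 1))
    {lam mu : ℕ → ℝ} (hint : Interlacing (fun j => lam j ^ 2) (fun k => mu k ^ 2))
    (hlim : Tendsto lam atTop (𝓝 0)) (hlim' : Tendsto mu atTop (𝓝 0)) :
    ∃ Γ : E →L[ℂ] E, IsSelfAdjoint Γ ∧ IsCompactOperator Γ ∧ Γ ∘L S = adjoint S ∘L Γ ∧
      (∀ z : ℂ, z ≠ 0 → (HasEigenvalue (Γ : E →ₗ[ℂ] E) z ↔ ∃ n : ℕ, z = (lam n : ℂ))) ∧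
      (∀ z : ℂ, z ≠ 0 → HasEigenvalue (Γ : E →ₗ[ℂ] E) z →
        Module.finrank ℂ (eigenspace (Γ : E →ₗ[ℂ] E) z) = 1) ∧
      (∀ z : ℂ, z ≠ 0 → (HasEigenvalue ((Γ ∘L S : E →L[ℂ] E) : E →ₗ[ℂ] E) z ↔
        ∃ n : ℕ, z = (mu n : ℂ))) ∧
      (∀ z : ℂ, z ≠ 0 → HasEigenvalue ((Γ ∘L S : E →L[ℂ] E) : E →ₗ[ℂ] E) z →
        Module.finrank ℂ (eigenspace ((Γ ∘L S : E →L[ℂ] E) : E →ₗ[ℂ] E) z) = 1) := by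
  have hlam : Function.Injective lam := fun i j h =>
    hint.strictAnti.injective (congrArg (· ^ 2) h)
  have hmu : Function.Injective mu := fun i j h =>
    hint.strictAnti_right.injective (congrArg (· ^ 2) h)
  have hlam0 (n) : lam n ≠ 0 := fun h => by simpa [h] using hint.pos_left n
  obtain ⟨A, hAsa, hAc, hA, -⟩ := exists_diagonal_operator e.orthonormal hlim
  obtain ⟨p, hp0, hps, hp1, hpsum⟩ := hint.exists_weights
  set ν : ℕ → ℝ := fun j => √(p j / lam j ^ 2) with hν
  have hν0 (j) : 0 < ν j := Real.sqrt_pos.2 (div_pos (hp0 j) (hint.pos_left j))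
  have hνsq (j) : ν j ^ 2 = p j / lam j ^ 2 :=
    Real.sq_sqrt (div_pos (hp0 j) (hint.pos_left j)).le
  have hνp (j) : lam j ^ 2 * ν j ^ 2 = p j := by
    rw [hνsq, mul_div_cancel₀ _ (hint.pos_left j).ne']
  have hs : Summable fun j => ν j ^ 2 := by simpa only [hνsq] using hps
  have hs1 : ∑' j, ν j ^ 2 ≤ 1 := by simpa only [hνsq] using hp1
  have hsum (k) : HasSum (fun j => lam j ^ 2 * ν j ^ 2 / (lam j ^ 2 - mu k ^ 2)) 1 := by
    simpa only [hνp] using hpsum k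
  obtain ⟨w, -, hw⟩ := exists_of_sum_sq_le e (s := fun j => (ν j : ℂ)) zero_le_one fun N => by
    simp only [Complex.norm_real, Real.norm_eq_abs, sq_abs, one_pow]
    exact (hs.sum_le_tsum _ fun j _ => sq_nonneg _).trans hs1
  obtain ⟨B, f, hBsa, hf0, hBf, hB0, hBB⟩ :=
    exists_square_root hint hlim hlim' hν0 hs hs1 hsum hA hAsa hAc hw
  obtain ⟨T, hTA, hAT, hTT⟩ := exists_contraction hlam0 hA hAsa hBsa hBB
  obtain ⟨W, hW⟩ := exists_analysis_operator e (fun n => innerSL ℂ w ∘L T ^ n)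
    (sum_norm_inner_pow_le hTT)
  have hTle (x) : ‖T x‖ ≤ ‖x‖ := by
    refine (pow_le_pow_iff_left₀ (norm_nonneg _) (norm_nonneg _) two_ne_zero).1 ?_
    rw [norm_sq_of_adjoint_apply hTT]
    exact sub_le_self _ (by positivity)
  have hSW (x) : adjoint S (W x) = W (T x) := ext_inner_hilbertBasis e fun n => by
    rw [← inner_basis_succ hS, hW, hW, pow_succ]
    rfl
  have hWe : adjoint W (e 0) = w := ext_inner_right ℂ fun x => by
    rw [adjoint_inner_left, hW]
    rfl
  have hSW' (x) : adjoint W (S x) = adjoint T (adjoint W x) := ext_inner_left ℂ fun y => by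
    rw [adjoint_inner_right, ← adjoint_inner_left, hSW, adjoint_inner_right, adjoint_inner_right]
  set R : E →L[ℂ] E := A ∘L (A - adjoint W ∘L W ∘L A) with hR
  have hRapp (x) : R x = A (A x) - A (adjoint W (W (A x))) := by
    simp [hR]
  have hRsa : IsSelfAdjoint R := by
    rw [ContinuousLinearMap.isSelfAdjoint_iff_isSymmetric]
    intro x y
    simp only [ContinuousLinearMap.coe_coe, hRapp, inner_sub_left, inner_sub_right]
    rw [hAsa.inner_apply_comm, hAsa.inner_apply_comm, hAsa.inner_apply_comm, adjoint_inner_left,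
      ← hAsa.inner_apply_comm x (adjoint W _), adjoint_inner_right]
  have hR0 : R = 0 := by
    refine eq_zero_of_conj_eq hRsa (hAc.comp_clm _) hTle (fun x => ?_)
      (contraction_no_unimodular_eigenvalue hTA hAT hTT fun y hy =>
        eq_zero_of_inner_pow_eq_zero hint.strictAnti hint.pos_left hν0 hA hAsa hw hy)
    have h1 : B (adjoint W (W (B x))) = A (adjoint W (W (A x))) - inner ℂ (A w) x • A w := by
      rw [← hTA x, ← hSW, ← hAT (adjoint W _), ← hSW', shift_adjoint_apply hS_iso hS, map_sub,
        map_smul, hWe, map_sub, map_smul, ← adjoint_inner_left, hWe, hAsa.inner_apply_comm]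
    rw [hRapp, hRapp, hAT, map_sub, hTA, hTA, h1, hBB]
    abel
  have hWW (x) : adjoint W (W x) = x := by
    have h1 (y) : adjoint W (W (A y)) = A y := by
      refine diagonal_injective hlam0 hA hAsa (sub_eq_zero.1 ?_).symm
      rw [← hRapp, hR0, zero_apply]
    have h2 : adjoint W ∘L W = ContinuousLinearMap.id ℂ E := by
      refine ContinuousLinearMap.ext_of_eqOn_of_orthogonal e (fun j => ?_) fun x hx => ?_
      · have hc : (lam j : ℂ) ≠ 0 := by exact_mod_cast hlam0 j
        have h3 := h1 (e j)
        rw [hA, map_smul, map_smul] at h3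
        exact smul_right_injective _ hc h3
      · simp [eq_zero_of_inner_hilbertBasis e hx]
    exact DFunLike.congr_fun h2 x
  have hconj {C : E →L[ℂ] E} (hC : IsSelfAdjoint C) : IsSelfAdjoint (W ∘L C ∘L adjoint W) := by
    rw [ContinuousLinearMap.isSelfAdjoint_iff', adjoint_comp, adjoint_comp, adjoint_adjoint,
      ContinuousLinearMap.isSelfAdjoint_iff'.1 hC, comp_assoc]
  have hne {x : E} (hx : x ≠ 0) : W x ≠ 0 := fun h => hx (by rw [← hWW x, h, map_zero])
  set Γ : E →L[ℂ] E := W ∘L A ∘L adjoint W with hΓ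
  have hΓS : Γ ∘L S = W ∘L B ∘L adjoint W := by
    ext x
    simp only [hΓ, comp_apply]
    rw [hSW', hAT]
  have hSΓ : adjoint S ∘L Γ = W ∘L B ∘L adjoint W := by
    ext x
    simp only [hΓ, comp_apply]
    rw [hSW, hTA]
  have hΓsa : IsSelfAdjoint Γ := hconj hAsa
  have hΓSsa : IsSelfAdjoint (Γ ∘L S) := hΓS ▸ hconj hBsa
  obtain ⟨h4, h5⟩ := eigen_of_diagonal hΓsa (g := fun j => W (e j))
    (fun j => hne (e.orthonormal.ne_zero j)) hlam
    (fun j => by simp only [hΓ, comp_apply]; rw [hWW, hA, map_smul]) fun x hx => by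
      have h0 : adjoint W x = 0 := eq_zero_of_inner_hilbertBasis e fun j => by
        rw [adjoint_inner_right, hx]
      simp [hΓ, h0]
  obtain ⟨h6, h7⟩ := eigen_of_diagonal hΓSsa (g := fun k => W (f k)) (fun k => hne (hf0 k)) hmu
    (fun k => by simp only [hΓS, comp_apply]; rw [hWW, hBf, map_smul]) fun x hx => by
      have h0 : B (adjoint W x) = 0 := hB0 _ fun k => by rw [adjoint_inner_right, hx]
      simp [hΓS, h0]
  exact ⟨Γ, hΓsa, (hAc.comp_clm (adjoint W)).clm_comp W, hΓS.trans hSΓ.symm, h4, h5, h6, h7⟩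

end Construction

/-- Given two sequences of non-zero real numbers `(λₙ)`, `(μₙ)` with
`|λ₁| > |μ₁| > |λ₂| > |μ₂| > … > 0` and `λₙ → 0`, there is a unique self-adjoint compact
Hankel operator `Γ` on `ℓ²` (modelled abstractly: `E` is a Hilbert space with orthonormal
basis `e` indexed by `ℕ`, and `S` is the forward shift, i.e. the isometry with
`S eₙ = eₙ₊₁`) such that all non-zero eigenvalues of `Γ` and of `ΓS` are simple, the
non-zero eigenvalues of `Γ` are exactly `{λₙ}`, and those of `ΓS` are exactly `{μₙ}`. -/
theorem statement_0
    {E : Type*} [NormedAddCommGroup E] [InnerProductSpace ℂ E] [CompleteSpace E]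
    (e : HilbertBasis ℕ ℂ E)
    (S : E →L[ℂ] E)
    (hS_iso : ∀ x : E, ‖S x‖ = ‖x‖)
    (hS_shift : ∀ n : ℕ, S (e n) = e (n + 1))
    (lam mu : ℕ → ℝ)
    (hlam_ne : ∀ n, lam n ≠ 0)
    (hmu_ne : ∀ n, mu n ≠ 0)
    (h1 : ∀ n, |mu n| < |lam n|)
    (h2 : ∀ n, |lam (n + 1)| < |mu n|)
    (hlim : Tendsto lam atTop (nhds 0)) :
    ∃! Γ : E →L[ℂ] E,
      IsSelfAdjoint Γ ∧
      IsCompactOperator Γ ∧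
      Γ ∘L S = adjoint S ∘L Γ ∧
      (∀ z : ℂ, z ≠ 0 →
        (Module.End.HasEigenvalue (Γ : E →ₗ[ℂ] E) z ↔ ∃ n : ℕ, z = (lam n : ℂ))) ∧
      (∀ z : ℂ, z ≠ 0 → Module.End.HasEigenvalue (Γ : E →ₗ[ℂ] E) z →
        Module.finrank ℂ (Module.End.eigenspace (Γ : E →ₗ[ℂ] E) z) = 1) ∧
      (∀ z : ℂ, z ≠ 0 →
        (Module.End.HasEigenvalue ((Γ ∘L S : E →L[ℂ] E) : E →ₗ[ℂ] E) z ↔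
          ∃ n : ℕ, z = (mu n : ℂ))) ∧
      (∀ z : ℂ, z ≠ 0 → Module.End.HasEigenvalue ((Γ ∘L S : E →L[ℂ] E) : E →ₗ[ℂ] E) z →
        Module.finrank ℂ (Module.End.eigenspace ((Γ ∘L S : E →L[ℂ] E) : E →ₗ[ℂ] E) z) = 1) := by
  have hint : Interlacing (fun j => lam j ^ 2) (fun k => mu k ^ 2) :=
    ⟨fun n => sq_lt_sq.2 (h1 n), fun n => sq_lt_sq.2 (h2 n),
      fun n => sq_pos_iff.2 (hmu_ne n), by simpa using hlim.pow 2⟩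
  have hlim' : Tendsto mu atTop (𝓝 0) :=
    squeeze_zero_norm (fun n => (h1 n).le) (by simpa using hlim.abs)
  obtain ⟨Γ, hΓ⟩ := exists_hankel hS_iso hS_shift hint hlim hlim'
  exact ⟨Γ, hΓ, fun Γ' hΓ' => hankel_unique hS_iso hS_shift hint hlim hΓ' hΓ⟩
end

section
/- Let (λₖ²)ₖ≥₁ and (μₖ²)ₖ≥₁ satisfy λ₁² > μ₁² > λ₂² > μ₂² > … > 0 with λₖ² → 0, set σ = {λₖ² : k ≥ 1} ∪ {0}, and let Φ(z) = ∏ₖ≥₁ (z − μₖ²)/(z − λₖ²). Suppose Φ₁ is an analytic function on ℂ∖σ satisfying: (1) Φ₁(z̄) = conj(Φ₁(z)) for all z ∈ ℂ∖σ; (2) each λₖ² is a simple pole of Φ₁, and the zeros of Φ₁ in ℂ∖σ are exactly the points μₖ², all simple; (3) Φ₁(z) → 1 as z → ∞; (4) Im Φ₁(z) < 0 for all z in the open upper half-plane. Then Φ₁ = Φ on ℂ∖σ. -/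
open Filter Topology

/-- The set `σ = {λₖ² : k ≥ 1} ∪ {0}`, as a subset of `ℂ`. -/
def sigmaSet (lam : ℕ → ℝ) : Set ℂ :=
  insert (0 : ℂ) (Set.range fun k : ℕ => ((lam k : ℝ) : ℂ))

/-- The `N`-th partial product of `∏ₖ (z − μₖ)/(z − λₖ)`. -/
noncomputable def partialProd (lam mu : ℕ → ℝ) (N : ℕ) (z : ℂ) : ℂ :=
  ∏ k ∈ Finset.range N, (z - (mu k : ℂ)) / (z - (lam k : ℂ))

lemma sub_ofReal_ne_zero {z : ℂ} (hz : z.im ≠ 0) (t : ℝ) : z - (t : ℂ) ≠ 0 := by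
  intro h
  apply hz
  simpa using congrArg Complex.im h

lemma im_inv_sub_ofReal_neg {z : ℂ} (hz : 0 < z.im) (t : ℝ) : ((z - (t : ℂ))⁻¹).im < 0 := by
  rw [Complex.inv_im]
  have h : 0 < Complex.normSq (z - t) := Complex.normSq_pos.2 (sub_ofReal_ne_zero hz.ne' t)
  simpa using div_neg_of_neg_of_pos (by simpa using hz) h

/-- The second conjunct is the strengthening that makes the induction go through. -/
lemma partialProd_im_nonpos_and {lam mu : ℕ → ℝ} (h1 : ∀ k, mu k < lam k)
    (h2 : ∀ k, lam (k + 1) < mu k) {z : ℂ} (hz : 0 < z.im) (N : ℕ) :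
    (partialProd lam mu N z).im ≤ 0 ∧
      ∀ t : ℝ, t ≤ lam N → (partialProd lam mu N z * (z - (t : ℂ))⁻¹).im < 0 := by
  induction N with
  | zero => simpa [partialProd] using fun t _ => by simpa using im_inv_sub_ofReal_neg hz t
  | succ N ih =>
    obtain ⟨ih1, ih2⟩ := ih
    have hlam := sub_ofReal_ne_zero hz.ne' (lam N)
    have hN := ih2 (lam N) le_rfl
    have hd := sub_pos.2 (h1 N)
    set Q := partialProd lam mu N z
    have hQ : partialProd lam mu (N + 1) z
        = Q * ((z - (mu N : ℂ)) / (z - (lam N : ℂ))) := Finset.prod_range_succ _ _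
    constructor
    · have : partialProd lam mu (N + 1) z
          = Q + ((lam N - mu N : ℝ) : ℂ) * (Q * (z - (lam N : ℂ))⁻¹) := by
        rw [hQ]
        field_simp
        push_cast
        ring
      rw [this, Complex.add_im, Complex.im_ofReal_mul]
      nlinarith
    · intro t ht
      have htmu : t < mu N := ht.trans_lt (h2 N)
      have htl : 0 < lam N - t := by linarith
      have htne : ((lam N : ℂ) - (t : ℂ)) ≠ 0 := by exact_mod_cast htl.ne'
      have hzt := sub_ofReal_ne_zero hz.ne' t
      have : partialProd lam mu (N + 1) z * (z - (t : ℂ))⁻¹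
          = (((lam N - mu N) / (lam N - t) : ℝ) : ℂ) * (Q * (z - (lam N : ℂ))⁻¹)
            + (((mu N - t) / (lam N - t) : ℝ) : ℂ) * (Q * (z - (t : ℂ))⁻¹) := by
        rw [hQ]
        push_cast
        field_simp
        ring
      rw [this, Complex.add_im, Complex.im_ofReal_mul, Complex.im_ofReal_mul]
      have ha : 0 < (lam N - mu N) / (lam N - t) := div_pos hd htl
      have hb : 0 < (mu N - t) / (lam N - t) := div_pos (by linarith) htl
      have := ih2 t (by linarith)
      nlinarith

lemma partialProd_conj (lam mu : ℕ → ℝ) (N : ℕ) (z : ℂ) :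
    partialProd lam mu N ((starRingEnd ℂ) z) = (starRingEnd ℂ) (partialProd lam mu N z) := by
  simp [partialProd, map_prod]

lemma div_mem_slitPlane_of_im {a b : ℂ} (ha : a.im < 0) (hb : b.im ≤ 0) (hb0 : b ≠ 0) :
    a / b ∈ Complex.slitPlane := by
  by_contra h
  rw [Complex.mem_slitPlane_iff, not_or, not_lt, not_not] at h
  have hab : a = a / b * b := by field_simp
  have := congrArg Complex.im hab
  rw [Complex.mul_im, h.2] at this
  nlinarith [mul_nonneg_of_nonpos_of_nonpos h.1 hb]

lemma eventually_ne_nhdsNE {X : Type*} [TopologicalSpace X] [T1Space X] (a b : X) :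
    ∀ᶠ z in 𝓝[≠] a, z ≠ b := by
  rcases eq_or_ne a b with rfl | h
  · exact self_mem_nhdsWithin
  · exact (eventually_ne_nhds h).filter_mono nhdsWithin_le_nhds

lemma eventually_notMem_sigmaSet {lam : ℕ → ℝ} (hlim : Tendsto lam atTop (𝓝 0))
    {z₀ : ℂ} (hz₀ : z₀ ≠ 0) : ∀ᶠ z in 𝓝[≠] z₀, z ∈ (sigmaSet lam)ᶜ := by
  have hpos : 0 < ‖z₀‖ := norm_pos_iff.2 hz₀
  have hlt : ‖(0 : ℝ)‖ < ‖z₀‖ / 2 := by rw [norm_zero]; linarith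
  obtain ⟨K, hK⟩ := eventually_atTop.1 (hlim.norm.eventually (gt_mem_nhds hlt))
  have hnorm : ∀ᶠ z in 𝓝[≠] z₀, ‖z₀‖ / 2 < ‖z‖ :=
    ((continuous_norm.tendsto z₀).eventually (lt_mem_nhds (by linarith))).filter_mono
      nhdsWithin_le_nhds
  have hfin : ∀ᶠ z in 𝓝[≠] z₀, ∀ k ∈ Finset.range K, z ≠ (lam k : ℂ) :=
    (Finset.eventually_all _).2 fun k _ => eventually_ne_nhdsNE _ _
  filter_upwards [hnorm, hfin] with z hz hzk hmem
  rcases hmem with rfl | ⟨k, rfl⟩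
  · simp at hz; linarith
  · rcases lt_or_ge k K with hk | hk
    · exact hzk k (Finset.mem_range.2 hk) rfl
    · have := hK k hk
      simp at hz this
      linarith

lemma isOpen_compl_sigmaSet {lam : ℕ → ℝ} (hlim : Tendsto lam atTop (𝓝 0)) :
    IsOpen (sigmaSet lam)ᶜ := by
  rw [isOpen_iff_mem_nhds]
  intro z hz
  have hz0 : z ≠ 0 := fun h => hz (h ▸ Set.mem_insert _ _)
  have := eventually_notMem_sigmaSet hlim hz0
  rw [eventually_nhdsWithin_iff] at this
  filter_upwards [this] with w hw
  rcases eq_or_ne w z with rfl | h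
  · exact hz
  · exact hw h

/-- Filling in removable singularities, with no bookkeeping of where they are. -/
lemma exists_differentiableOn_extension {U : Set ℂ} {f : ℂ → ℂ}
    (hd : ∀ w ∈ U, ∀ᶠ z in 𝓝[≠] w, DifferentiableAt ℂ f z)
    (hl : ∀ w ∈ U, ∃ c, c ≠ 0 ∧ Tendsto f (𝓝[≠] w) (𝓝 c)) :
    ∃ h : ℂ → ℂ, DifferentiableOn ℂ h U ∧
      ∀ w ∈ U, h w ≠ 0 ∧ Tendsto f (𝓝[≠] w) (𝓝 (h w)) := by
  have hcont : ∀ z, ContinuousAt f z → limUnder (𝓝[≠] z) f = f z := fun z hz =>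
    (hz.tendsto.mono_left nhdsWithin_le_nhds).limUnder_eq
  have htend : ∀ w ∈ U, limUnder (𝓝[≠] w) f ≠ 0 ∧
      Tendsto f (𝓝[≠] w) (𝓝 (limUnder (𝓝[≠] w) f)) := by
    intro w hw
    obtain ⟨c, hc, hfc⟩ := hl w hw
    rw [hfc.limUnder_eq]
    exact ⟨hc, hfc⟩
  refine ⟨fun w => limUnder (𝓝[≠] w) f, fun w hw => ?_, htend⟩
  have heq : (fun w => limUnder (𝓝[≠] w) f) =ᶠ[𝓝[≠] w] f := by
    filter_upwards [hd w hw] with z hz using hcont z hz.continuousAt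
  refine (Complex.analyticAt_of_differentiable_on_punctured_nhds_of_continuousAt ?_
    ?_).differentiableAt.differentiableWithinAt
  · filter_upwards [hd w hw, eventually_eventually_nhdsWithin.2 (hd w hw),
      self_mem_nhdsWithin] with z hz hz' hzw
    have hz'' : ∀ᶠ y in 𝓝 z, DifferentiableAt ℂ f y := by
      rwa [isOpen_compl_singleton.nhdsWithin_eq hzw] at hz'
    exact hz.congr_of_eventuallyEq (hz''.mono fun y hy => hcont y hy.continuousAt)
  · rw [continuousAt_iff_punctured_nhds]
    exact (htend w hw).2.congr' heq.symm

/-- A quantitative Liouville theorem for functions with values in the slit plane. -/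
lemma norm_log_le_of_mapsTo_slitPlane {h : ℂ → ℂ} {R : ℝ} (hR : 0 < R)
    (hd : DifferentiableOn ℂ h (Metric.ball 0 R))
    (hs : ∀ w ∈ Metric.ball (0 : ℂ) R, h w ∈ Complex.slitPlane) (h0 : h 0 = 1)
    {w : ℂ} (hw : w ∈ Metric.ball (0 : ℂ) R) :
    ‖Complex.log (h w)‖ ≤ 2 * Real.pi * ‖w‖ / (R - ‖w‖) := by
  have key := Complex.borelCaratheodory_zero (f := fun w => -Complex.I * Complex.log (h w))
    Real.pi_pos ((hd.clog hs).const_mul _) (fun x _ => ?_) hR hw (by simp [h0])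
  · simpa using key
  · simpa [Complex.log_im] using Complex.arg_le_pi (h x)

lemma mu_ne_lam {lam mu : ℕ → ℝ} (h1 : ∀ k, mu k < lam k) (h2 : ∀ k, lam (k + 1) < mu k)
    (j k : ℕ) : mu j ≠ lam k := by
  have hanti : StrictAnti lam := strictAnti_nat_of_succ_lt fun k => (h2 k).trans (h1 k)
  rcases le_or_gt k j with h | h
  · exact ((h1 j).trans_le (hanti.antitone h)).ne
  · exact ((hanti.antitone (Nat.succ_le_of_lt h)).trans_lt (h2 j)).ne'

lemma mu_injective {lam mu : ℕ → ℝ} (h1 : ∀ k, mu k < lam k) (h2 : ∀ k, lam (k + 1) < mu k) :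
    Function.Injective mu :=
  (strictAnti_nat_of_succ_lt fun k => (h1 (k + 1)).trans (h2 k)).injective

lemma lam_injective {lam mu : ℕ → ℝ} (h1 : ∀ k, mu k < lam k) (h2 : ∀ k, lam (k + 1) < mu k) :
    Function.Injective lam :=
  (strictAnti_nat_of_succ_lt fun k => (h2 k).trans (h1 k)).injective

lemma partialProd_ne_zero {lam mu : ℕ → ℝ} {N : ℕ} {z : ℂ} (hz : z ∈ (sigmaSet lam)ᶜ)
    (hzmu : ∀ k < N, z ≠ (mu k : ℂ)) : partialProd lam mu N z ≠ 0 := by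
  refine Finset.prod_ne_zero_iff.2 fun k hk => div_ne_zero ?_ ?_
  · exact sub_ne_zero.2 (hzmu k (Finset.mem_range.1 hk))
  · exact sub_ne_zero.2 fun h => hz (Or.inr ⟨k, h.symm⟩)

lemma differentiableAt_prod_div {lam mu : ℕ → ℝ} {z : ℂ} (s : Finset ℕ)
    (hz : ∀ k ∈ s, z ≠ (lam k : ℂ)) :
    DifferentiableAt ℂ (fun z : ℂ => ∏ k ∈ s, (z - (mu k : ℂ)) / (z - (lam k : ℂ))) z := by
  refine DifferentiableAt.fun_finsetProd fun k hk => ?_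
  have := sub_ne_zero.2 (hz k hk)
  fun_prop (disch := assumption)

lemma differentiableAt_div_partialProd {lam mu : ℕ → ℝ} (hlim : Tendsto lam atTop (𝓝 0))
    {Φ₁ : ℂ → ℂ} (hd : DifferentiableOn ℂ Φ₁ (sigmaSet lam)ᶜ) {N : ℕ} {z : ℂ}
    (hz : z ∈ (sigmaSet lam)ᶜ) (hzmu : ∀ k < N, z ≠ (mu k : ℂ)) :
    DifferentiableAt ℂ (fun z => Φ₁ z / partialProd lam mu N z) z :=
  (hd.differentiableAt ((isOpen_compl_sigmaSet hlim).mem_nhds hz)).div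
    (differentiableAt_prod_div _ fun k _ h => hz (Or.inr ⟨k, h.symm⟩))
    (partialProd_ne_zero hz hzmu)

lemma exists_tendsto_div_partialProd {lam mu : ℕ → ℝ} (hmu_pos : ∀ k, 0 < mu k)
    (h1 : ∀ k, mu k < lam k) (h2 : ∀ k, lam (k + 1) < mu k) (hlim : Tendsto lam atTop (𝓝 0))
    {Φ₁ : ℂ → ℂ} (hd : DifferentiableOn ℂ Φ₁ (sigmaSet lam)ᶜ)
    (hpoles : ∀ k : ℕ, ∃ c : ℂ, c ≠ 0 ∧
      Tendsto (fun z : ℂ => (z - (lam k : ℂ)) * Φ₁ z)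
        (𝓝[(sigmaSet lam)ᶜ] (lam k : ℂ)) (𝓝 c))
    (hzeros : ∀ k : ℕ, Φ₁ (mu k : ℂ) = 0 ∧ deriv Φ₁ (mu k : ℂ) ≠ 0)
    (hzeros_only : ∀ z ∈ (sigmaSet lam)ᶜ, Φ₁ z = 0 → ∃ k : ℕ, z = (mu k : ℂ))
    (N : ℕ) {z₀ : ℂ} (hz₀ : lam N < ‖z₀‖) :
    ∃ c, c ≠ 0 ∧ Tendsto (fun z => Φ₁ z / partialProd lam mu N z) (𝓝[≠] z₀) (𝓝 c) := by
  have hlam_pos : ∀ k, 0 < lam k := fun k => (hmu_pos k).trans (h1 k)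
  have hanti : StrictAnti lam := strictAnti_nat_of_succ_lt fun k => (h2 k).trans (h1 k)
  have hz0 : z₀ ≠ 0 := norm_pos_iff.1 ((hlam_pos N).trans hz₀)
  by_cases hmem : z₀ ∈ (sigmaSet lam)ᶜ
  · by_cases hzmu : ∃ j < N, z₀ = (mu j : ℂ)
    · obtain ⟨j, hj, rfl⟩ := hzmu
      have hjmem := Finset.mem_range.2 hj
      have hΦd : DifferentiableAt ℂ Φ₁ (mu j : ℂ) :=
        hd.differentiableAt ((isOpen_compl_sigmaSet hlim).mem_nhds hmem)
      have hslope := hΦd.hasDerivAt.tendsto_slope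
      have hne : ∀ k, (mu j : ℂ) ≠ (lam k : ℂ) := fun k => by
        exact_mod_cast mu_ne_lam h1 h2 j k
      have hrest := (differentiableAt_prod_div (lam := lam) (mu := mu) (z := (mu j : ℂ))
        ((Finset.range N).erase j) fun k _ => hne k).continuousAt.tendsto.mono_left
        (nhdsWithin_le_nhds (s := {(mu j : ℂ)}ᶜ))
      have hrest0 : ∏ k ∈ (Finset.range N).erase j,
          ((mu j : ℂ) - (mu k : ℂ)) / ((mu j : ℂ) - (lam k : ℂ)) ≠ 0 := by
        refine Finset.prod_ne_zero_iff.2 fun k hk => div_ne_zero ?_ (sub_ne_zero.2 (hne k))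
        refine sub_ne_zero.2 fun h => Finset.ne_of_mem_erase hk ?_
        exact (mu_injective h1 h2 (by exact_mod_cast h)).symm
      have hlin : Tendsto (fun z : ℂ => z - (lam j : ℂ)) (𝓝[≠] (mu j : ℂ))
          (𝓝 ((mu j : ℂ) - (lam j : ℂ))) :=
        ((continuous_id.sub continuous_const).tendsto _).mono_left nhdsWithin_le_nhds
      refine ⟨_, ?_, ((hslope.mul hlin).div hrest hrest0).congr' ?_⟩
      · exact div_ne_zero (mul_ne_zero (hzeros j).2 (sub_ne_zero.2 (hne j))) hrest0
      · filter_upwards with z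
        rw [partialProd, ← Finset.mul_prod_erase _ _ hjmem]
        simp only [Pi.div_apply, slope_def_field, (hzeros j).1, sub_zero,
          div_eq_mul_inv, mul_inv, inv_inv]
        ring
    · push Not at hzmu
      refine ⟨_, div_ne_zero ?_ (partialProd_ne_zero hmem hzmu),
        (differentiableAt_div_partialProd hlim hd hmem hzmu).continuousAt.tendsto.mono_left
          nhdsWithin_le_nhds⟩
      intro h0
      obtain ⟨k, rfl⟩ := hzeros_only _ hmem h0
      rw [Complex.norm_real, Real.norm_of_nonneg (hmu_pos k).le] at hz₀
      exact hzmu k (hanti.lt_iff_gt.1 (hz₀.trans (h1 k))) rfl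
  · rcases not_not.1 hmem with h | ⟨j, rfl⟩
    · exact absurd h hz0
    · dsimp only at hz₀ hz0 hmem ⊢
      rw [Complex.norm_real, Real.norm_of_nonneg (hlam_pos j).le] at hz₀
      have hj : j < N := hanti.lt_iff_gt.1 hz₀
      have hjmem := Finset.mem_range.2 hj
      obtain ⟨c, hc, hcl⟩ := hpoles j
      have hcl' : Tendsto (fun z : ℂ => (z - (lam j : ℂ)) * Φ₁ z) (𝓝[≠] (lam j : ℂ)) (𝓝 c) :=
        hcl.mono_left (le_inf nhdsWithin_le_nhds
          (le_principal_iff.2 (eventually_notMem_sigmaSet hlim hz0)))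
      have hne : ∀ k, (lam j : ℂ) ≠ (mu k : ℂ) := fun k => by
        exact_mod_cast (mu_ne_lam h1 h2 k j).symm
      have hne' : ∀ k ∈ (Finset.range N).erase j, (lam j : ℂ) ≠ (lam k : ℂ) := fun k hk h =>
        Finset.ne_of_mem_erase hk (lam_injective h1 h2 (by exact_mod_cast h)).symm
      have hrest := (differentiableAt_prod_div (lam := lam) (mu := mu) (z := (lam j : ℂ))
        ((Finset.range N).erase j) hne').continuousAt.tendsto.mono_left
        (nhdsWithin_le_nhds (s := {(lam j : ℂ)}ᶜ))
      have hrest0 : ∏ k ∈ (Finset.range N).erase j,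
          ((lam j : ℂ) - (mu k : ℂ)) / ((lam j : ℂ) - (lam k : ℂ)) ≠ 0 :=
        Finset.prod_ne_zero_iff.2 fun k hk =>
          div_ne_zero (sub_ne_zero.2 (hne k)) (sub_ne_zero.2 (hne' k hk))
      have hlin : Tendsto (fun z : ℂ => z - (mu j : ℂ)) (𝓝[≠] (lam j : ℂ))
          (𝓝 ((lam j : ℂ) - (mu j : ℂ))) :=
        ((continuous_id.sub continuous_const).tendsto _).mono_left nhdsWithin_le_nhds
      have hlin0 := sub_ne_zero.2 (hne j)
      refine ⟨_, ?_, ((hcl'.div hlin hlin0).div hrest hrest0).congr' ?_⟩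
      · exact div_ne_zero (div_ne_zero hc hlin0) hrest0
      · filter_upwards with z
        rw [partialProd, ← Finset.mul_prod_erase _ _ hjmem]
        simp only [Pi.div_apply, Pi.mul_apply, Pi.inv_apply, div_eq_mul_inv, mul_inv, inv_inv]
        ring

lemma tendsto_partialProd_cobounded (lam mu : ℕ → ℝ) (N : ℕ) :
    Tendsto (partialProd lam mu N) (Bornology.cobounded ℂ) (𝓝 1) := by
  have h : ∀ k ∈ Finset.range N, Tendsto (fun z : ℂ => (z - (mu k : ℂ)) / (z - (lam k : ℂ)))
      (Bornology.cobounded ℂ) (𝓝 1) := by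
    intro k _
    have hsub : Tendsto (fun z : ℂ => z - (lam k : ℂ)) (Bornology.cobounded ℂ)
        (Bornology.cobounded ℂ) := tendsto_sub_const_cobounded _
    have hinv := (tendsto_inv₀_cobounded.comp hsub).const_mul ((lam k : ℂ) - (mu k : ℂ))
    have := hinv.const_add 1
    rw [mul_zero, add_zero] at this
    refine this.congr' ?_
    filter_upwards [hsub.eventually (Bornology.eventually_ne_cobounded (0 : ℂ))] with z hz
    simp only [Function.comp_apply]
    field_simp
    ring
  have := tendsto_finsetProd _ h
  rwa [Finset.prod_const_one] at this

lemma inv_mem_compl_sigmaSet {lam mu : ℕ → ℝ} {w : ℂ} (hw : w.im ≠ 0) :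
    w⁻¹ ∈ (sigmaSet lam)ᶜ ∧ ∀ k, w⁻¹ ≠ (mu k : ℂ) := by
  have him : ∀ t : ℝ, w⁻¹ ≠ (t : ℂ) := by
    intro t h
    apply hw
    rw [← inv_inv w, h, ← Complex.ofReal_inv, Complex.ofReal_im]
  refine ⟨?_, fun k => him _⟩
  rintro (h | ⟨k, hk⟩)
  · exact him 0 (by simpa using h)
  · exact him _ hk.symm

lemma tendsto_inv_nhdsNE {w₀ : ℂ} (hw₀ : w₀ ≠ 0) :
    Tendsto (fun w : ℂ => w⁻¹) (𝓝[≠] w₀) (𝓝[≠] w₀⁻¹) :=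
  tendsto_nhdsWithin_iff.2 ⟨(continuousAt_inv₀ hw₀).tendsto.mono_left nhdsWithin_le_nhds,
    eventually_mem_nhdsWithin.mono fun _ hw h => hw (inv_injective h)⟩

lemma eventually_inv_mem {lam mu : ℕ → ℝ} (hlim : Tendsto lam atTop (𝓝 0)) (N : ℕ) (w₀ : ℂ) :
    ∀ᶠ w in 𝓝[≠] w₀, w⁻¹ ∈ (sigmaSet lam)ᶜ ∧ ∀ k < N, w⁻¹ ≠ (mu k : ℂ) := by
  have hmu : ∀ᶠ w in 𝓝[≠] w₀, ∀ k ∈ Finset.range N, w ≠ (mu k : ℂ)⁻¹ :=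
    (Finset.eventually_all _).2 fun k _ => eventually_ne_nhdsNE _ _
  have hsig : ∀ᶠ w in 𝓝[≠] w₀, w⁻¹ ∈ (sigmaSet lam)ᶜ := by
    rcases eq_or_ne w₀ 0 with rfl | hw₀
    · obtain ⟨B, hB⟩ := hlim.norm.bddAbove_range
      filter_upwards [tendsto_norm_inv_nhdsNE_zero_atTop.eventually (eventually_gt_atTop B),
        self_mem_nhdsWithin] with w hw hw0
      rintro (h | ⟨k, hk⟩)
      · exact hw0 (inv_eq_zero.1 h)
      · have := hB ⟨k, rfl⟩
        rw [← hk, Complex.norm_real] at hw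
        exact absurd this hw.not_ge
    · exact (tendsto_inv_nhdsNE hw₀).eventually
        (eventually_notMem_sigmaSet hlim (inv_ne_zero hw₀))
  filter_upwards [hmu, hsig] with w hw1 hw2
  exact ⟨hw2, fun k hk h => hw1 k (Finset.mem_range.2 hk) (by rw [← h, inv_inv])⟩

/-- A continuous function on a disc that is real and nonzero on the real diameter, and takes a
positive value at the centre, is positive on the real diameter. -/
lemma re_pos_of_im_eq_zero {h : ℂ → ℂ} {R : ℝ} (hc : ContinuousOn h (Metric.ball 0 R))
    (hne : ∀ w ∈ Metric.ball (0 : ℂ) R, h w ≠ 0) (h0 : h 0 = 1)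
    (him : ∀ x : ℝ, (x : ℂ) ∈ Metric.ball (0 : ℂ) R → (h x).im = 0)
    {x : ℝ} (hx : (x : ℂ) ∈ Metric.ball (0 : ℂ) R) : 0 < (h x).re := by
  by_contra! hle
  have hmem : ∀ y : ℝ, y ∈ Metric.ball (0 : ℝ) R → (y : ℂ) ∈ Metric.ball (0 : ℂ) R := by simp
  have hx' : x ∈ Metric.ball (0 : ℝ) R := by simpa using hx
  have hR : (0 : ℝ) ∈ Metric.ball (0 : ℝ) R := Metric.mem_ball_self (Metric.pos_of_mem_ball hx)
  have hcont : ContinuousOn (fun y : ℝ => (h y).re) (Metric.ball 0 R) :=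
    Complex.continuous_re.comp_continuousOn
      (hc.comp Complex.continuous_ofReal.continuousOn hmem)
  obtain ⟨y, hy, hy0⟩ := (convex_ball (0 : ℝ) R).isPreconnected.intermediate_value hx' hR hcont
    (show (0 : ℝ) ∈ Set.Icc _ _ from ⟨hle, by simp [h0]⟩)
  exact hne y (hmem y hy) (Complex.ext hy0 (him y (hmem y hy)))

/-- Quantitative form of uniqueness: the quotient of `Φ₁` by a partial product is close to `1`. -/
lemma norm_log_div_partialProd_le {lam mu : ℕ → ℝ} (hmu_pos : ∀ k, 0 < mu k)
    (h1 : ∀ k, mu k < lam k) (h2 : ∀ k, lam (k + 1) < mu k) (hlim : Tendsto lam atTop (𝓝 0))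
    {Φ₁ : ℂ → ℂ} (hd : DifferentiableOn ℂ Φ₁ (sigmaSet lam)ᶜ)
    (hconj : ∀ z ∈ (sigmaSet lam)ᶜ, Φ₁ ((starRingEnd ℂ) z) = (starRingEnd ℂ) (Φ₁ z))
    (hpoles : ∀ k : ℕ, ∃ c : ℂ, c ≠ 0 ∧
      Tendsto (fun z : ℂ => (z - (lam k : ℂ)) * Φ₁ z)
        (𝓝[(sigmaSet lam)ᶜ] (lam k : ℂ)) (𝓝 c))
    (hzeros : ∀ k : ℕ, Φ₁ (mu k : ℂ) = 0 ∧ deriv Φ₁ (mu k : ℂ) ≠ 0)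
    (hzeros_only : ∀ z ∈ (sigmaSet lam)ᶜ, Φ₁ z = 0 → ∃ k : ℕ, z = (mu k : ℂ))
    (hinfty : Tendsto Φ₁ (Bornology.cobounded ℂ) (𝓝 1))
    (hherglotz : ∀ z : ℂ, 0 < z.im → (Φ₁ z).im < 0)
    {z : ℂ} (hz : z ∈ (sigmaSet lam)ᶜ) {N : ℕ} (hzmu : ∀ k < N, z ≠ (mu k : ℂ))
    (hzN : z⁻¹ ∈ Metric.ball (0 : ℂ) (lam N)⁻¹) :
    Φ₁ z / partialProd lam mu N z ≠ 0 ∧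
    ‖Complex.log (Φ₁ z / partialProd lam mu N z)‖
      ≤ 2 * Real.pi * ‖z⁻¹‖ / ((lam N)⁻¹ - ‖z⁻¹‖) := by
  have hlam : 0 < lam N := (hmu_pos N).trans (h1 N)
  set F : ℂ → ℂ := fun z => Φ₁ z / partialProd lam mu N z with hF
  set f : ℂ → ℂ := fun w => F w⁻¹ with hf
  have hFd : ∀ z, z ∈ (sigmaSet lam)ᶜ → (∀ k < N, z ≠ (mu k : ℂ)) → DifferentiableAt ℂ F z :=
    fun z hz hzmu => differentiableAt_div_partialProd hlim hd hz hzmu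
  have hfd : ∀ w, w⁻¹ ∈ (sigmaSet lam)ᶜ → (∀ k < N, w⁻¹ ≠ (mu k : ℂ)) →
      DifferentiableAt ℂ f w := fun w hw hwmu =>
    (hFd _ hw hwmu).comp w (differentiableAt_inv fun h => hw (Or.inl (by simp [h])))
  have hFconj : ∀ z ∈ (sigmaSet lam)ᶜ, F ((starRingEnd ℂ) z) = (starRingEnd ℂ) (F z) := by
    intro z hz
    simp only [hF, hconj z hz, partialProd_conj, map_div₀]
  have hF1 : Tendsto F (Bornology.cobounded ℂ) (𝓝 1) := by
    have := hinfty.div (tendsto_partialProd_cobounded lam mu N) one_ne_zero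
    rwa [div_one] at this
  have hf1 : Tendsto f (𝓝[≠] 0) (𝓝 1) := hF1.comp tendsto_inv₀_nhdsNE_zero
  have hlimits : ∀ w ∈ Metric.ball (0 : ℂ) (lam N)⁻¹,
      ∃ c, c ≠ 0 ∧ Tendsto f (𝓝[≠] w) (𝓝 c) := by
    intro w hw
    rcases eq_or_ne w 0 with rfl | hw0
    · exact ⟨1, one_ne_zero, hf1⟩
    · have hnorm : lam N < ‖w⁻¹‖ := by
        rw [norm_inv, lt_inv_comm₀ hlam (norm_pos_iff.2 hw0)]
        simpa using hw
      obtain ⟨c, hc, hcl⟩ := exists_tendsto_div_partialProd hmu_pos h1 h2 hlim hd hpoles hzeros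
        hzeros_only N hnorm
      exact ⟨c, hc, hcl.comp (tendsto_inv_nhdsNE hw0)⟩
  obtain ⟨h, hhd, hh⟩ := exists_differentiableOn_extension
    (fun w _ => (eventually_inv_mem (mu := mu) hlim N w).mono fun w' hw' => hfd w' hw'.1 hw'.2)
    hlimits
  have hR : (0 : ℝ) < (lam N)⁻¹ := inv_pos.2 hlam
  have heq : ∀ w ∈ Metric.ball (0 : ℂ) (lam N)⁻¹, w⁻¹ ∈ (sigmaSet lam)ᶜ →
      (∀ k < N, w⁻¹ ≠ (mu k : ℂ)) → h w = f w := fun w hw hws hwmu =>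
    tendsto_nhds_unique (hh w hw).2
      ((hfd w hws hwmu).continuousAt.tendsto.mono_left nhdsWithin_le_nhds)
  have h0 : h 0 = 1 := tendsto_nhds_unique (hh 0 (Metric.mem_ball_self hR)).2 hf1
  have hupper : ∀ z : ℂ, 0 < z.im → z ∈ (sigmaSet lam)ᶜ → (∀ k < N, z ≠ (mu k : ℂ)) →
      F z ∈ Complex.slitPlane := fun z hzi hzs hzmu =>
    div_mem_slitPlane_of_im (hherglotz z hzi) (partialProd_im_nonpos_and h1 h2 hzi N).1
      (partialProd_ne_zero hzs hzmu)
  have hreal : ∀ x : ℝ, (x : ℂ) ∈ Metric.ball (0 : ℂ) (lam N)⁻¹ → (h x).im = 0 := by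
    intro x hx
    have hofReal : Tendsto (fun t : ℝ => (t : ℂ)) (𝓝[≠] x) (𝓝[≠] (x : ℂ)) :=
      tendsto_nhdsWithin_iff.2
        ⟨(Complex.continuous_ofReal.tendsto x).mono_left nhdsWithin_le_nhds,
          eventually_mem_nhdsWithin.mono fun _ ht hxt => ht (Complex.ofReal_injective hxt)⟩
    have hlim_im := (Complex.continuous_im.tendsto _).comp ((hh x hx).2.comp hofReal)
    refine tendsto_nhds_unique hlim_im (tendsto_const_nhds.congr' ?_)
    filter_upwards [hofReal.eventually (eventually_inv_mem (mu := mu) hlim N x)] with t ht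
    have := hFconj _ ht.1
    rw [← Complex.ofReal_inv, Complex.conj_ofReal] at this
    simp only [Function.comp_apply, hf]
    rw [← Complex.ofReal_inv]
    exact (Complex.conj_eq_iff_im.1 this.symm).symm
  have hslit : ∀ w ∈ Metric.ball (0 : ℂ) (lam N)⁻¹, h w ∈ Complex.slitPlane := by
    intro w hw
    rcases eq_or_ne w.im 0 with hwi | hwi
    · obtain ⟨x, rfl⟩ : ∃ x : ℝ, (x : ℂ) = w :=
        ⟨w.re, Complex.ext rfl (by simpa using hwi.symm)⟩
      exact Or.inl (re_pos_of_im_eq_zero hhd.continuousOn (fun w hw => (hh w hw).1) h0 hreal hw)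
    · obtain ⟨hws, hwmu⟩ := inv_mem_compl_sigmaSet (lam := lam) (mu := mu) hwi
      rw [heq w hw hws fun k _ => hwmu k]
      have hns : 0 < Complex.normSq w := Complex.normSq_pos.2 fun h => hwi (by simp [h])
      rcases hwi.lt_or_gt with hneg | hpos
      · refine hupper _ ?_ hws fun k _ => hwmu k
        rw [Complex.inv_im]
        exact div_pos (neg_pos.2 hneg) hns
      · have hci : ((starRingEnd ℂ) w).im ≠ 0 := by simpa using hwi
        obtain ⟨hcs, hcmu⟩ := inv_mem_compl_sigmaSet (lam := lam) (mu := mu) hci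
        have hcu : F (((starRingEnd ℂ) w)⁻¹) ∈ Complex.slitPlane := by
          refine hupper _ ?_ hcs fun k _ => hcmu k
          rw [Complex.inv_im, Complex.normSq_conj]
          exact div_pos (by simpa using hpos) hns
        rw [← map_inv₀, hFconj _ hws] at hcu
        simpa [Complex.mem_slitPlane_iff] using hcu
  have hkey := norm_log_le_of_mapsTo_slitPlane hR hhd hslit h0 hzN
  have hval : h z⁻¹ = F z := by
    rw [heq _ hzN (by rwa [inv_inv]) (by rwa [inv_inv])]
    simp only [hf, inv_inv]
  have hne := (hh _ hzN).1
  rw [hval] at hkey hne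
  exact ⟨hne, hkey⟩

/-- Let `(λₖ²)`, `(μₖ²)` (here `lam`, `mu`) satisfy
`λ₁² > μ₁² > λ₂² > μ₂² > … > 0` with `λₖ² → 0`, `σ = {λₖ²} ∪ {0}`, and let
`Φ(z) = ∏ₖ (z − μₖ²)/(z − λₖ²)` (characterized as the pointwise limit of partial
products). Suppose `Φ₁` is analytic on `ℂ∖σ` and satisfies: (1) `Φ₁(z̄) = conj (Φ₁ z)`;
(2) each `λₖ²` is a simple pole of `Φ₁` (i.e. `(z − λₖ²)Φ₁(z)` has a non-zero limit
there) and the zeros of `Φ₁` in `ℂ∖σ` are exactly the points `μₖ²`, all simple;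
(3) `Φ₁(z) → 1` as `z → ∞`; (4) `Im Φ₁ < 0` on the open upper half-plane.
Then `Φ₁ = Φ` on `ℂ∖σ`. -/
theorem statement_16
    (lam mu : ℕ → ℝ)
    (hmu_pos : ∀ k, 0 < mu k)
    (h1 : ∀ k, mu k < lam k)
    (h2 : ∀ k, lam (k + 1) < mu k)
    (hlim : Tendsto lam atTop (nhds 0))
    (Φ : ℂ → ℂ)
    (hΦ : ∀ z ∈ (sigmaSet lam)ᶜ,
      Tendsto (fun N : ℕ => ∏ k ∈ Finset.range N, (z - (mu k : ℂ)) / (z - (lam k : ℂ)))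
        atTop (nhds (Φ z)))
    (Φ₁ : ℂ → ℂ)
    (hΦ₁_diff : DifferentiableOn ℂ Φ₁ (sigmaSet lam)ᶜ)
    (hΦ₁_conj : ∀ z ∈ (sigmaSet lam)ᶜ, Φ₁ ((starRingEnd ℂ) z) = (starRingEnd ℂ) (Φ₁ z))
    (hΦ₁_poles : ∀ k : ℕ, ∃ c : ℂ, c ≠ 0 ∧
      Tendsto (fun z : ℂ => (z - (lam k : ℂ)) * Φ₁ z)
        (nhdsWithin ((lam k : ℂ)) (sigmaSet lam)ᶜ) (nhds c))
    (hΦ₁_zeros : ∀ k : ℕ, Φ₁ ((mu k : ℂ)) = 0 ∧ deriv Φ₁ ((mu k : ℂ)) ≠ 0)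
    (hΦ₁_zeros_only : ∀ z ∈ (sigmaSet lam)ᶜ, Φ₁ z = 0 → ∃ k : ℕ, z = (mu k : ℂ))
    (hΦ₁_infty : Tendsto Φ₁ (Filter.comap norm atTop) (nhds 1))
    (hΦ₁_herglotz : ∀ z : ℂ, 0 < z.im → (Φ₁ z).im < 0) :
    ∀ z ∈ (sigmaSet lam)ᶜ, Φ₁ z = Φ z := by
  intro z hz
  rw [comap_norm_atTop] at hΦ₁_infty
  by_cases hmu : ∃ k, z = (mu k : ℂ)
  · obtain ⟨k, rfl⟩ := hmu
    rw [(hΦ₁_zeros k).1]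
    refine tendsto_nhds_unique (tendsto_const_nhds.congr' ?_) (hΦ _ hz)
    filter_upwards [eventually_gt_atTop k] with N hN
    exact (Finset.prod_eq_zero (Finset.mem_range.2 hN) (by simp)).symm
  · push Not at hmu
    have hlam_pos : ∀ k, 0 < lam k := fun k => (hmu_pos k).trans (h1 k)
    have hR : Tendsto (fun N => (lam N)⁻¹) atTop atTop :=
      tendsto_inv_nhdsGT_zero.comp
        (tendsto_nhdsWithin_iff.2 ⟨hlim, Eventually.of_forall hlam_pos⟩)
    have hbound : ∀ᶠ N in atTop, Φ₁ z / partialProd lam mu N z ≠ 0 ∧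
        ‖Complex.log (Φ₁ z / partialProd lam mu N z)‖
          ≤ 2 * Real.pi * ‖z⁻¹‖ / ((lam N)⁻¹ - ‖z⁻¹‖) := by
      filter_upwards [hR.eventually (eventually_gt_atTop ‖z⁻¹‖)] with N hN
      exact norm_log_div_partialProd_le hmu_pos h1 h2 hlim hΦ₁_diff hΦ₁_conj hΦ₁_poles hΦ₁_zeros
        hΦ₁_zeros_only hΦ₁_infty hΦ₁_herglotz hz (fun k _ => hmu k) (by simpa using hN)
    have hlog : Tendsto (fun N => Complex.log (Φ₁ z / partialProd lam mu N z)) atTop (𝓝 0) :=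
      squeeze_zero_norm' (hbound.mono fun _ h => h.2)
        (tendsto_const_nhds.div_atTop (tendsto_atTop_add_const_right _ _ hR))
    have hquot : Tendsto (fun N => Φ₁ z / partialProd lam mu N z) atTop (𝓝 1) := by
      have := (Complex.continuous_exp.tendsto 0).comp hlog
      rw [Complex.exp_zero] at this
      exact this.congr' (hbound.mono fun _ h => Complex.exp_log h.1)
    have hprod : Tendsto (fun N => Φ₁ z / partialProd lam mu N z * partialProd lam mu N z) atTop
        (𝓝 (1 * Φ z)) := hquot.mul (hΦ z hz)
    rw [one_mul] at hprod
    refine tendsto_nhds_unique (tendsto_const_nhds.congr' ?_) hprod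
    filter_upwards with N
    exact (div_mul_cancel₀ _ (partialProd_ne_zero hz fun k _ => hmu k)).symm
end
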